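/- Let B be an even simple Bratteli diagram with full group G=G_B and path space X=X_B, and suppose (X,G) admits exactly k ergodic G-invariant Borel probability measures μ_1,…,μ_k (1≤k<∞). Let φ be an atomless ergodic invariant random subgroup of G admitting nonnegative reals c_∞ and c_α (α∈Z_{≥0}^k) with c_∞+Σ_α c_α=1 such that φ(Fix_{Sub(G)}(g)) = c_∞·1_{g=e} + Σ_α c_α·μ_α(Fix_{X^{|α|}}(g)) for every g∈G. Let {Ξ_n} be a nested sequence of finite partitions of X into clopen sets with max_{C∈Ξ_n} diam(C)→0, let r≥1, and let N be such that for all p≤r, n≥N and all C̄,D̄∈Ξ_{p,n} one has (∪C̄)∪(∪D̄)≠X. Then for any n≥N and any p≤r: φ(⋃_{C̄∈Ξ_{p,n}} F(∪C̄)) = Σ_{α∈Z_{≥0}^k} c_α·μ_α(⋃_{C̄∈Ξ_{p,n}} (∪C̄)^{|α|}). -/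

import Mathlib

open MeasureTheory Filter
open scoped ENNReal ComplexOrder

noncomputable section

/-- A Bratteli diagram: vertex levels `V i`, edge levels `E i` (edges from `V i` to `V (i+1)`),
all levels finite and nonempty, a single root vertex, and source/range maps that are
surjective (every vertex emits and receives an edge). -/
structure BratteliDiagram where
  V : ℕ → Type
  E : ℕ → Type
  fintypeV : ∀ i, Fintype (V i)
  fintypeE : ∀ i, Fintype (E i)
  nonemptyV : ∀ i, Nonempty (V i)
  nonemptyE : ∀ i, Nonempty (E i)
  subsingleton_root : Subsingleton (V 0)
  src : ∀ i, E i → V i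
  rng : ∀ i, E i → V (i + 1)
  src_surj : ∀ i, Function.Surjective (src i)
  rng_surj : ∀ i, Function.Surjective (rng i)

namespace BratteliDiagram

variable (B : BratteliDiagram)

/-- The path space `X_B`: infinite paths starting at the root. -/
def Path : Type :=
  { x : ∀ i, B.E i // ∀ i, B.rng i (x i) = B.src (i + 1) (x (i + 1)) }

instance (i : ℕ) : UniformSpace (B.E i) := ⊥

instance instUniformSpacePath : UniformSpace B.Path :=
  inferInstanceAs (UniformSpace { x : ∀ i, B.E i // ∀ i, B.rng i (x i) = B.src (i + 1) (x (i + 1)) })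

instance instMeasurableSpacePath : MeasurableSpace B.Path := borel _

/-- Finite segments of `L+1` consecutive edges starting at level `n`. -/
def Seg (n L : ℕ) : Type :=
  { f : ∀ i : Fin (L + 1), B.E (n + (i : ℕ)) //
    ∀ (i : ℕ) (hi : i < L),
      B.rng (n + i) (f ⟨i, by omega⟩) = B.src (n + (i + 1)) (f ⟨i + 1, by omega⟩) }

/-- The number of finite paths connecting `v ∈ V n` to `w ∈ V (n + L + 1)`. -/
def numPaths (n L : ℕ) (v : B.V n) (w : B.V (n + L + 1)) : ℕ :=
  Nat.card { f : B.Seg n L //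
    B.src n (f.1 ⟨0, by omega⟩) = v ∧ B.rng (n + L) (f.1 ⟨L, by omega⟩) = w }

/-- A Bratteli diagram is simple if every vertex of a given level is connected
to every vertex of some deeper level. -/
def IsSimple : Prop :=
  ∀ n : ℕ, ∃ L : ℕ, ∀ (v : B.V n) (w : B.V (n + L + 1)), 0 < B.numPaths n L v w

/-- A Bratteli diagram is even if every vertex of a given level is connected to every
vertex of some deeper level by a (positive) even number of paths. -/
def IsEven : Prop :=
  ∀ n : ℕ, ∃ L : ℕ, ∀ (v : B.V n) (w : B.V (n + L + 1)),
    0 < B.numPaths n L v w ∧ Even (B.numPaths n L v w)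

/-- A permutation of the path space "of level `n`": it changes only the first `n` edges,
and what it does to the first `n` edges depends only on the first `n` edges. -/
def IsLevel (n : ℕ) (g : Equiv.Perm B.Path) : Prop :=
  (∀ (x : B.Path) (i : ℕ), n ≤ i → (g x).1 i = x.1 i) ∧
  (∀ x y : B.Path, (∀ i : ℕ, i < n → x.1 i = y.1 i) → ∀ i : ℕ, i < n → (g x).1 i = (g y).1 i)

theorem isLevel_one (n : ℕ) : B.IsLevel n 1 :=
  ⟨fun _ _ _ => rfl, fun _ _ h i hi => h i hi⟩

theorem IsLevel.mul {n : ℕ} {a b : Equiv.Perm B.Path} (ha : B.IsLevel n a)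
    (hb : B.IsLevel n b) : B.IsLevel n (a * b) := by
  constructor
  · intro x i hi
    have h1 := ha.1 (b x) i hi
    have h2 := hb.1 x i hi
    simpa [Equiv.Perm.mul_apply] using h1.trans h2
  · intro x y hxy i hi
    have h2 := hb.2 x y hxy
    have := ha.2 (b x) (b y) h2 i hi
    simpa [Equiv.Perm.mul_apply] using this

theorem IsLevel.mono {n m : ℕ} (hnm : n ≤ m) {g : Equiv.Perm B.Path}
    (h : B.IsLevel n g) : B.IsLevel m g := by
  refine ⟨fun x i hi => h.1 x i (hnm.trans hi), fun x y hxy i hi => ?_⟩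
  rcases lt_or_ge i n with h' | h'
  · exact h.2 x y (fun j hj => hxy j (hj.trans_le hnm)) i h'
  · rw [h.1 x i h', h.1 y i h']
    exact hxy i hi

/-- The group `G_n` of homeomorphisms of the path space permuting only the
first `n` edges of infinite paths. -/
def level (n : ℕ) : Subgroup (Equiv.Perm B.Path) where
  carrier := { g | B.IsLevel n g ∧ B.IsLevel n g⁻¹ }
  one_mem' := ⟨B.isLevel_one n, by simpa using B.isLevel_one n⟩
  mul_mem' := by
    intro a b ha hb
    exact ⟨ha.1.mul B hb.1, by rw [mul_inv_rev]; exact IsLevel.mul B hb.2 ha.2⟩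
  inv_mem' := by
    intro a ha
    exact ⟨ha.2, by simpa using ha.1⟩

theorem level_mono {n m : ℕ} (h : n ≤ m) : B.level n ≤ B.level m := by
  intro g hg
  exact ⟨hg.1.mono B h, hg.2.mono B h⟩

/-- The full group `G_B = ⋃ n, G_n` of the Bratteli diagram. -/
def fullGroup : Subgroup (Equiv.Perm B.Path) where
  carrier := { g | ∃ n, g ∈ B.level n }
  one_mem' := ⟨0, one_mem _⟩
  mul_mem' := by
    rintro a b ⟨n, ha⟩ ⟨m, hb⟩
    exact ⟨max n m, mul_mem (B.level_mono (le_max_left n m) ha)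
      (B.level_mono (le_max_right n m) hb)⟩
  inv_mem' := by
    rintro a ⟨n, ha⟩
    exact ⟨n, inv_mem ha⟩

/-- `G_n` viewed as a subgroup of the full group. -/
def levelIn (n : ℕ) : Subgroup ↥B.fullGroup := (B.level n).comap B.fullGroup.subtype

/-- The subgroup `G°(A)` of elements of the full group fixing `A` pointwise. -/
def Gcirc (A : Set B.Path) : Subgroup ↥B.fullGroup :=
  ⨅ x ∈ A, MulAction.stabilizer ↥B.fullGroup x

/-- `G°_n(A) = G_n ∩ G°(A)`. -/
def GcircN (n : ℕ) (A : Set B.Path) : Subgroup ↥B.fullGroup :=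
  B.levelIn n ⊓ B.Gcirc A

end BratteliDiagram

/-- Conjugation of a subgroup: `g • H = gHg⁻¹`. -/
def conjSub {Γ : Type*} [Group Γ] (g : Γ) (H : Subgroup Γ) : Subgroup Γ :=
  Subgroup.map (MulAut.conj g).toMonoidHom H

/-- The Borel structure on the space `Sub(Γ)` of subgroups of `Γ`,
induced from the product space `{0,1}^Γ` (equivalently `Set Γ`). -/
instance subgroupMeasurableSpace {Γ : Type*} [Group Γ] : MeasurableSpace (Subgroup Γ) :=
  MeasurableSpace.comap (fun H => (H : Set Γ)) inferInstance

namespace BratteliDiagram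

variable (B : BratteliDiagram)

/-- `F(A)`: the collection of subgroups of the full group normalized by `G°(A)`. -/
def FF (A : Set B.Path) : Set (Subgroup ↥B.fullGroup) :=
  { H | ∀ g ∈ B.Gcirc A, conjSub g H = H }

end BratteliDiagram

/-- A measure `ν` on `Y` is invariant under the action of `G`. -/
def MeasInv (G : Type*) [Group G] {Y : Type*} [MeasurableSpace Y] [MulAction G Y]
    (ν : Measure Y) : Prop :=
  ∀ (g : G) (s : Set Y), MeasurableSet s → ν ((fun y => g • y) ⁻¹' s) = ν s

/-- The action of `G` on `(Y, ν)` is ergodic: every invariant measurable set is null or conull. -/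
def MeasErg (G : Type*) [Group G] {Y : Type*} [MeasurableSpace Y] [MulAction G Y]
    (ν : Measure Y) : Prop :=
  ∀ s : Set Y, MeasurableSet s → (∀ g : G, (fun y => g • y) ⁻¹' s = s) → ν s = 0 ∨ ν s = 1

/-- An invariant random subgroup: a conjugation-invariant Borel probability measure on `Sub(G)`. -/
def IsIRS (G : Type*) [Group G] (φ : Measure (Subgroup G)) : Prop :=
  IsProbabilityMeasure φ ∧
    ∀ (g : G) (s : Set (Subgroup G)), MeasurableSet s → φ (conjSub g ⁻¹' s) = φ s

/-- An ergodic invariant random subgroup. -/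
def IsErgodicIRS (G : Type*) [Group G] (φ : Measure (Subgroup G)) : Prop :=
  IsIRS G φ ∧
    ∀ s : Set (Subgroup G), MeasurableSet s → (∀ g : G, conjSub g ⁻¹' s = s) →
      φ s = 0 ∨ φ s = 1

/-- A character of a group: normalized, central, positive semidefinite complex function. -/
def IsCharacter (G : Type*) [Group G] (χ : G → ℂ) : Prop :=
  χ 1 = 1 ∧ (∀ a b : G, χ (a * b) = χ (b * a)) ∧
    ∀ (n : ℕ) (g : Fin n → G) (c : Fin n → ℂ),
      0 ≤ ∑ i, ∑ j, (starRingEnd ℂ) (c i) * c j * χ (g i * (g j)⁻¹)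

namespace BratteliDiagram

variable (B : BratteliDiagram)

/-- The product measure `μ_α = μ_1^{α_1} × ⋯ × μ_k^{α_k}` on `X^{|α|}`,
realized on the index type `Σ i : Fin k, Fin (α i)` (of cardinality `|α| = Σ α i`). -/
def prodMeasure {k : ℕ} (μ : Fin k → Measure B.Path) (α : Fin k → ℕ) :
    Measure ((Σ i : Fin k, Fin (α i)) → B.Path) :=
  Measure.pi fun p => μ p.1

/-- The stabilizer distribution `φ_α` of the diagonal action of the full group
on `(X^{|α|}, μ_α)`. -/
def stabDist {k : ℕ} (μ : Fin k → Measure B.Path) (α : Fin k → ℕ) :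
    Measure (Subgroup ↥B.fullGroup) :=
  Measure.map (fun y => MulAction.stabilizer ↥B.fullGroup y) (B.prodMeasure μ α)

end BratteliDiagram

namespace BratteliDiagram

variable (B : BratteliDiagram)

instance instFiniteE (i : ℕ) : Finite (B.E i) := @Finite.of_fintype _ (B.fintypeE i)

instance instDiscE (i : ℕ) : DiscreteTopology (B.E i) := ⟨rfl⟩

instance instBorelPath : BorelSpace B.Path := ⟨rfl⟩

variable {B}

/-- agreement of two paths on the first `m` edges -/
def ag (m : ℕ) (x y : B.Path) : Prop := ∀ i, i < m → x.1 i = y.1 i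

/-- the vertex of level `m` -/
def vtx (m : ℕ) (x : B.Path) : B.V m := B.src m (x.1 m)

/-- initial segment of length `m` -/
def pre (m : ℕ) (x : B.Path) : ∀ i : Fin m, B.E i := fun i => x.1 i

theorem ag_iff_pre {m : ℕ} {x y : B.Path} : ag m x y ↔ pre m x = pre m y := by
  constructor
  · intro h
    funext i
    exact h i i.2
  · intro h i hi
    exact congrFun h ⟨i, hi⟩

theorem ag_refl {m : ℕ} (x : B.Path) : ag m x x := fun _ _ => rfl

theorem ag_symm {m : ℕ} {x y : B.Path} (h : ag m x y) : ag m y x := fun i hi => (h i hi).symm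

theorem ag_trans {m : ℕ} {x y z : B.Path} (h : ag m x y) (h' : ag m y z) : ag m x z :=
  fun i hi => (h i hi).trans (h' i hi)

theorem ag_mono {m n : ℕ} (hmn : n ≤ m) {x y : B.Path} (h : ag m x y) : ag n x y :=
  fun i hi => h i (hi.trans_le hmn)

theorem path_ext {x y : B.Path} (h : ∀ i, x.1 i = y.1 i) : x = y := Subtype.ext (funext h)

theorem vtx_eq_of_ag {m : ℕ} {x y : B.Path} (h : ag m x y) : vtx m x = vtx m y := by
  cases m with
  | zero => exact B.subsingleton_root.elim _ _
  | succ m =>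
    unfold vtx
    rw [← x.2 m, ← y.2 m, h m (Nat.lt_succ_self m)]

theorem eq_of_ag_of_tail {m : ℕ} {x y : B.Path} (h : ag m x y) (h' : ∀ i, m ≤ i → x.1 i = y.1 i) :
    x = y := by
  apply path_ext
  intro i
  rcases lt_or_ge i m with hi | hi
  · exact h i hi
  · exact h' i hi

/-- splice -/
def splice (m : ℕ) (x y : B.Path) (h : vtx m x = vtx m y) : B.Path :=
  ⟨fun i => if i < m then x.1 i else y.1 i, by
    intro i
    by_cases h1 : i + 1 < m
    · have h2 : i < m := by omega
      simp only [h1, h2, if_true]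
      exact x.2 i
    · by_cases h2 : i < m
      · have h3 : m = i + 1 := by omega
        subst h3
        simp only [h1, h2, if_true, if_false]
        rw [x.2 i]
        exact h
      · simp only [h1, h2, if_false]
        exact y.2 i⟩

theorem splice_ag {m : ℕ} {x y : B.Path} (h : vtx m x = vtx m y) : ag m (splice m x y h) x := by
  intro i hi
  simp [splice, hi]

theorem splice_tail {m : ℕ} {x y : B.Path} (h : vtx m x = vtx m y) (i : ℕ) (hi : m ≤ i) :
    (splice m x y h).1 i = y.1 i := by
  simp [splice, not_lt.mpr hi]

/-- make a group element from a level `m` involution -/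
def mkInvol (m : ℕ) (t : B.Path → B.Path) (ht : Function.Involutive t)
    (h1 : ∀ x i, m ≤ i → (t x).1 i = x.1 i) (h2 : ∀ x y, ag m x y → ag m (t x) (t y)) :
    ↥B.fullGroup :=
  ⟨ht.toPerm t, m, ⟨h1, h2⟩, ⟨h1, h2⟩⟩

theorem mkInvol_smul {m : ℕ} {t : B.Path → B.Path} (ht : Function.Involutive t)
    (h1 : ∀ x i, m ≤ i → (t x).1 i = x.1 i) (h2 : ∀ x y, ag m x y → ag m (t x) (t y))
    (z : B.Path) : mkInvol m t ht h1 h2 • z = t z := rfl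

theorem mkInvol_mem {m : ℕ} {t : B.Path → B.Path} (ht : Function.Involutive t)
    (h1 : ∀ x i, m ≤ i → (t x).1 i = x.1 i) (h2 : ∀ x y, ag m x y → ag m (t x) (t y)) :
    mkInvol m t ht h1 h2 ∈ B.levelIn m := ⟨⟨h1, h2⟩, ⟨h1, h2⟩⟩

theorem G_ext {g h : ↥B.fullGroup} (H : ∀ x : B.Path, g • x = h • x) : g = h :=
  Subtype.ext (Equiv.ext H)

theorem lev_tail {m : ℕ} {g : ↥B.fullGroup} (hg : g ∈ B.levelIn m) (x : B.Path) (i : ℕ)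
    (hi : m ≤ i) : (g • x).1 i = x.1 i := hg.1.1 x i hi

theorem lev_ag {m : ℕ} {g : ↥B.fullGroup} (hg : g ∈ B.levelIn m) {x y : B.Path}
    (h : ag m x y) : ag m (g • x) (g • y) := hg.1.2 x y h

theorem lev_ag_iff {m : ℕ} {g : ↥B.fullGroup} (hg : g ∈ B.levelIn m) {x y : B.Path} :
    ag m (g • x) (g • y) ↔ ag m x y := by
  constructor
  · intro h
    have := lev_ag (inv_mem hg) h
    simpa using this
  · exact lev_ag hg

theorem lev_vtx {m : ℕ} {g : ↥B.fullGroup} (hg : g ∈ B.levelIn m) (x : B.Path) :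
    vtx m (g • x) = vtx m x := by
  unfold vtx
  rw [lev_tail hg x m le_rfl]

theorem lev_mono {m n : ℕ} (h : n ≤ m) : B.levelIn n ≤ B.levelIn m :=
  fun _ hg => B.level_mono h hg

theorem exists_lev (g : ↥B.fullGroup) : ∃ m, g ∈ B.levelIn m := g.2

theorem mem_Gcirc {A : Set B.Path} {g : ↥B.fullGroup} :
    g ∈ B.Gcirc A ↔ ∀ x ∈ A, g • x = x := by
  simp [Gcirc, Subgroup.mem_iInf, MulAction.mem_stabilizer_iff]

open Classical in
/-- the function underlying `tau` -/
def tauFun (m : ℕ) (x y : B.Path) (h : vtx m x = vtx m y) (z : B.Path) : B.Path :=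
  if hx : ag m x z then splice m y z (h.symm.trans (vtx_eq_of_ag hx))
  else if hy : ag m y z then splice m x z (h.trans (vtx_eq_of_ag hy)) else z

theorem tauFun_tail {m : ℕ} {x y : B.Path} (h : vtx m x = vtx m y) (z : B.Path) (i : ℕ)
    (hi : m ≤ i) : (tauFun m x y h z).1 i = z.1 i := by
  unfold tauFun
  split_ifs <;> simp [splice_tail, hi]

theorem tauFun_left {m : ℕ} {x y : B.Path} (h : vtx m x = vtx m y) {z : B.Path} (hz : ag m x z) :
    ag m y (tauFun m x y h z) := by
  unfold tauFun
  rw [dif_pos hz]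
  exact ag_symm (splice_ag _)

theorem tauFun_right {m : ℕ} {x y : B.Path} (h : vtx m x = vtx m y) {z : B.Path} (hz : ag m y z) :
    ag m x (tauFun m x y h z) := by
  by_cases hx : ag m x z
  · exact ag_trans (ag_trans hx (ag_symm hz)) (tauFun_left h hx)
  · unfold tauFun
    rw [dif_neg hx, dif_pos hz]
    exact ag_symm (splice_ag _)

theorem tauFun_else {m : ℕ} {x y : B.Path} (h : vtx m x = vtx m y) {z : B.Path}
    (hx : ¬ ag m x z) (hy : ¬ ag m y z) : tauFun m x y h z = z := by
  unfold tauFun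
  rw [dif_neg hx, dif_neg hy]

theorem tauFun_invol {m : ℕ} {x y : B.Path} (h : vtx m x = vtx m y) :
    Function.Involutive (tauFun m x y h) := by
  intro z
  apply eq_of_ag_of_tail (m := m)
  · by_cases hx : ag m x z
    · exact ag_trans (ag_symm (tauFun_right h (tauFun_left h hx))) hx
    · by_cases hy : ag m y z
      · exact ag_trans (ag_symm (tauFun_left h (tauFun_right h hy))) hy
      · rw [tauFun_else h hx hy, tauFun_else h hx hy]
        exact ag_refl z
  · intro i hi
    rw [tauFun_tail h _ i hi, tauFun_tail h _ i hi]

theorem tauFun_ag {m : ℕ} {x y : B.Path} (h : vtx m x = vtx m y) (z w : B.Path) (hzw : ag m z w) :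
    ag m (tauFun m x y h z) (tauFun m x y h w) := by
  by_cases hx : ag m x z
  · exact ag_trans (ag_symm (tauFun_left h hx)) (tauFun_left h (ag_trans hx hzw))
  · by_cases hy : ag m y z
    · exact ag_trans (ag_symm (tauFun_right h hy)) (tauFun_right h (ag_trans hy hzw))
    · rw [tauFun_else h hx hy, tauFun_else h (fun h' => hx (ag_trans h' (ag_symm hzw)))
        (fun h' => hy (ag_trans h' (ag_symm hzw)))]
      exact hzw

/-- transposition of two initial segments of length `m` -/
def tau (m : ℕ) (x y : B.Path) (h : vtx m x = vtx m y) : ↥B.fullGroup :=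
  mkInvol m (tauFun m x y h) (tauFun_invol h) (tauFun_tail h) (tauFun_ag h)

section tau
variable {m : ℕ} {x y : B.Path} (h : vtx m x = vtx m y)

theorem tau_mem : tau m x y h ∈ B.levelIn m := mkInvol_mem _ _ _

theorem tau_left {z : B.Path} (hz : ag m x z) : ag m y (tau m x y h • z) := tauFun_left h hz

theorem tau_right {z : B.Path} (hz : ag m y z) : ag m x (tau m x y h • z) := tauFun_right h hz

theorem tau_else {z : B.Path} (hx : ¬ ag m x z) (hy : ¬ ag m y z) : tau m x y h • z = z :=
  tauFun_else h hx hy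

theorem tau_sq : tau m x y h * tau m x y h = 1 := by
  apply G_ext
  intro z
  rw [mul_smul, one_smul]
  exact tauFun_invol h z

theorem tau_uniq {g : ↥B.fullGroup} (hg : g ∈ B.levelIn m) (h1 : ∀ z, ag m x z → ag m y (g • z))
    (h2 : ∀ z, ag m y z → ag m x (g • z)) (h3 : ∀ z, ¬ ag m x z → ¬ ag m y z → g • z = z) :
    g = tau m x y h := by
  apply G_ext
  intro z
  apply eq_of_ag_of_tail (m := m)
  · by_cases hx : ag m x z
    · exact ag_trans (ag_symm (h1 z hx)) (tau_left h hx)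
    · by_cases hy : ag m y z
      · exact ag_trans (ag_symm (h2 z hy)) (tau_right h hy)
      · rw [h3 z hx hy, tau_else h hx hy]
        exact ag_refl z
  · intro i hi
    rw [lev_tail hg z i hi, lev_tail (tau_mem h) z i hi]

theorem tau_symm : tau m x y h = tau m y x h.symm :=
  tau_uniq h.symm (tau_mem h) (fun _ hz => tau_right h hz) (fun _ hz => tau_left h hz)
    (fun _ h1 h2 => tau_else h h2 h1)

theorem tau_congr {x' y' : B.Path} (h' : vtx m x' = vtx m y') (hx : ag m x x') (hy : ag m y y') :
    tau m x y h = tau m x' y' h' :=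
  tau_uniq h' (tau_mem h) (fun _ hz => ag_trans (ag_symm hy) (tau_left h (ag_trans hx hz)))
    (fun _ hz => ag_trans (ag_symm hx) (tau_right h (ag_trans hy hz)))
    (fun _ h1 h2 => tau_else h (fun k => h1 (ag_trans (ag_symm hx) k))
      (fun k => h2 (ag_trans (ag_symm hy) k)))

theorem tau_self (hxy : ag m x y) : tau m x y h = 1 := by
  symm
  apply tau_uniq h (one_mem _)
  · intro z hz
    rw [one_smul]
    exact ag_trans (ag_symm hxy) hz
  · intro z hz
    rw [one_smul]
    exact ag_trans hxy hz
  · intro z _ _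
    rw [one_smul]

theorem tau_conj {g : ↥B.fullGroup} (hg : g ∈ B.levelIn m) (h' : vtx m (g • x) = vtx m (g • y)) :
    g * tau m x y h * g⁻¹ = tau m (g • x) (g • y) h' := by
  have key : ∀ w z : B.Path, ag m (g • w) z ↔ ag m w (g⁻¹ • z) := by
    intro w z
    rw [← lev_ag_iff hg (x := w), smul_inv_smul]
  apply tau_uniq h' (mul_mem (mul_mem hg (tau_mem h)) (inv_mem hg))
  · intro z hz
    rw [mul_smul, mul_smul, lev_ag_iff hg]
    exact tau_left h ((key _ _).1 hz)
  · intro z hz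
    rw [mul_smul, mul_smul, lev_ag_iff hg]
    exact tau_right h ((key _ _).1 hz)
  · intro z h1 h2
    rw [mul_smul, mul_smul, tau_else h (fun k => h1 ((key _ _).2 k)) (fun k => h2 ((key _ _).2 k)),
      smul_inv_smul]

end tau

/-- saturated sets -/
def Sat (m : ℕ) (A : Set B.Path) : Prop := ∀ x y, ag m x y → x ∈ A → y ∈ A

theorem Sat.mono {m n : ℕ} (h : n ≤ m) {A : Set B.Path} (hA : Sat n A) : Sat m A :=
  fun x y hxy => hA x y (ag_mono h hxy)

theorem tau_mem_Gcirc {m : ℕ} {A : Set B.Path} (hA : Sat m A) {x y : B.Path}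
    (h : vtx m x = vtx m y) (hx : x ∉ A) (hy : y ∉ A) : tau m x y h ∈ B.Gcirc A := by
  rw [mem_Gcirc]
  intro z hz
  exact tau_else h (fun k => hx (hA _ _ (ag_symm k) hz)) (fun k => hy (hA _ _ (ag_symm k) hz))

/-- the set of transpositions at level `m` off `A` -/
def tauSet (m : ℕ) (A : Set B.Path) : Set ↥B.fullGroup :=
  {g | ∃ (x y : B.Path) (h : vtx m x = vtx m y), x ∉ A ∧ y ∉ A ∧ g = tau m x y h}

theorem mem_closure_tau {m : ℕ} {A : Set B.Path} (g : ↥B.fullGroup) (hg : g ∈ B.levelIn m)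
    (hgA : g ∈ B.Gcirc A) (hA : Sat m A) : g ∈ Subgroup.closure (tauSet m A) := by
  induction hc : (pre m '' {z : B.Path | g • z ≠ z}).ncard using Nat.strong_induction_on
    generalizing g with
  | _ c ih =>
    by_cases h1 : g = 1
    · rw [h1]
      exact one_mem _
    · have : ∃ x : B.Path, g • x ≠ x := by
        by_contra hcon
        push Not at hcon
        exact h1 (G_ext (fun x => by rw [hcon x, one_smul]))
      obtain ⟨x, hx⟩ := this
      have hv : vtx m x = vtx m (g • x) := (lev_vtx hg x).symm
      have hxA : x ∉ A := fun k => hx (mem_Gcirc.1 hgA x k)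
      have hyA : g • x ∉ A := by
        intro k
        have := mem_Gcirc.1 hgA _ k
        exact hx (by simpa using this)
      have ht := tau_mem_Gcirc hA hv hxA hyA
      set t := tau m x (g • x) hv with htdef
      have hsub : pre m '' {z : B.Path | (t * g) • z ≠ z} ⊂ pre m '' {z : B.Path | g • z ≠ z} := by
        have key : ∀ z : B.Path, g • z = z → (t * g) • z = z := by
          intro z hz
          rw [mul_smul, hz]
          apply tau_else
          · intro k
            apply hx
            apply eq_of_ag_of_tail (m := m) _ (fun i hi => lev_tail hg x i hi)
            have := lev_ag hg k
            rw [hz] at this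
            exact ag_trans this (ag_symm k)
          · intro k
            apply hx
            apply eq_of_ag_of_tail (m := m) _ (fun i hi => lev_tail hg x i hi)
            rw [← lev_ag_iff hg, ]
            refine ag_trans (lev_ag hg k) ?_
            rw [hz]
            exact ag_symm k
        have key2 : ∀ z, ag m x z → (t * g) • z = z := by
          intro z hz
          apply eq_of_ag_of_tail (m := m)
          · rw [mul_smul]
            exact ag_trans (ag_symm (tau_right hv (lev_ag hg hz))) hz
          · intro i hi
            rw [lev_tail (mul_mem (tau_mem hv) hg) z i hi]
        refine ⟨?_, ?_⟩
        · rintro _ ⟨z, hz, rfl⟩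
          exact ⟨z, fun k => hz (key z k), rfl⟩
        · intro hcon
          obtain ⟨z, hz, hz'⟩ := hcon ⟨x, hx, rfl⟩
          exact hz (key2 z (ag_symm (ag_iff_pre.2 hz')))
      have hlt := Set.ncard_lt_ncard hsub (Set.toFinite _)
      have hmem := ih _ (hc ▸ hlt) (t * g) (mul_mem (tau_mem hv) hg) (mul_mem ht hgA) rfl
      have ht' : t ∈ Subgroup.closure (tauSet m A) :=
        Subgroup.subset_closure ⟨x, g • x, hv, hxA, hyA, rfl⟩
      have := mul_mem (inv_mem ht') hmem
      simpa using this

end BratteliDiagram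
namespace BratteliDiagram

variable {B : BratteliDiagram}

theorem path_val_continuous : Continuous (fun x : B.Path => x.1) := continuous_subtype_val

theorem coord_continuous (i : ℕ) : Continuous (fun x : B.Path => x.1 i) :=
  (continuous_apply i).comp path_val_continuous

theorem path_isClosed_range :
    IsClosed {x : ∀ i, B.E i | ∀ i, B.rng i (x i) = B.src (i + 1) (x (i + 1))} := by
  rw [Set.ofPred_forall]
  apply isClosed_iInter
  intro i
  have : {x : ∀ i, B.E i | B.rng i (x i) = B.src (i + 1) (x (i + 1))}
      = (fun x : ∀ i, B.E i => (x i, x (i + 1))) ⁻¹'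
        {p : B.E i × B.E (i + 1) | B.rng i p.1 = B.src (i + 1) p.2} := rfl
  rw [this]
  exact (isClosed_discrete _).preimage (by fun_prop)

instance instCompactPath : CompactSpace B.Path :=
  isCompact_iff_compactSpace.1 (path_isClosed_range (B := B)).isCompact

theorem pre_continuous (m : ℕ) : Continuous (fun x : B.Path => pre m x) :=
  continuous_pi fun i => coord_continuous (i : ℕ)

theorem Sat.isClopen {m : ℕ} {A : Set B.Path} (hA : Sat m A) : IsClopen A := by
  have : A = pre m ⁻¹' (pre m '' A) := by
    apply Set.Subset.antisymm (Set.subset_preimage_image _ _)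
    rintro x ⟨y, hy, hyx⟩
    exact hA y x (ag_iff_pre.2 hyx) hy
  rw [this]
  exact (isClopen_discrete _).preimage (pre_continuous m)

theorem exists_cyl {A : Set B.Path} (hA : IsOpen A) {x : B.Path} (hx : x ∈ A) :
    ∃ m, ∀ y, ag m x y → y ∈ A := by
  obtain ⟨U, hU, rfl⟩ := isOpen_induced_iff.1 hA
  obtain ⟨I, u, h1, h2⟩ := isOpen_pi_iff.1 hU _ hx
  refine ⟨I.sup id + 1, fun y hy => h2 ?_⟩
  intro i hi
  have hlt : i < I.sup id + 1 := Nat.lt_succ_of_le (Finset.le_sup (f := id) hi)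
  have := (h1 i hi).2
  have h3 := hy i hlt
  change y.1 i ∈ u i
  rw [← h3]
  exact this

theorem exists_sat {A : Set B.Path} (hA : IsClopen A) : ∃ m, Sat m A := by
  have : ∃ m, ∀ x ∈ A, ∀ y, ag m x y → y ∈ A := by
    apply hA.1.isCompact.induction_on (p := fun S => ∃ m, ∀ x ∈ S, ∀ y, ag m x y → y ∈ A)
    · exact ⟨0, fun x hx => hx.elim⟩
    · rintro s t hst ⟨m, hm⟩
      exact ⟨m, fun x hx => hm x (hst hx)⟩
    · rintro s t ⟨m, hm⟩ ⟨m', hm'⟩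
      refine ⟨max m m', ?_⟩
      rintro x (hx | hx) y hy
      · exact hm x hx y (ag_mono (le_max_left _ _) hy)
      · exact hm' x hx y (ag_mono (le_max_right _ _) hy)
    · intro x hx
      obtain ⟨m, hm⟩ := exists_cyl hA.2 hx
      refine ⟨{y | ag m x y}, ?_, m, fun z hz y hy => hm y (ag_trans hz hy)⟩
      apply mem_nhdsWithin_of_mem_nhds
      apply IsOpen.mem_nhds _ (ag_refl x)
      apply IsClopen.isOpen
      apply Sat.isClopen (m := m)
      intro z y hzy hz
      exact ag_trans hz hzy
  obtain ⟨m, hm⟩ := this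
  exact ⟨m, fun x y hxy hx => hm x hx y hxy⟩

theorem exists_join (n L : ℕ) (x t : B.Path) (f : B.Seg n L)
    (hs : B.src n (f.1 ⟨0, by omega⟩) = vtx n x)
    (hr : B.rng (n + L) (f.1 ⟨L, by omega⟩) = vtx (n + L + 1) t) :
    ∃ z : B.Path, (∀ i, i < n → z.1 i = x.1 i) ∧
      (∀ i (hi : i < L + 1), z.1 (n + i) = f.1 ⟨i, hi⟩) ∧ ∀ i, n + L + 1 ≤ i → z.1 i = t.1 i := by
  have : ∀ i, ∃ e : B.E i, (i < n → e = x.1 i) ∧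
      (∀ j (hj : j < L + 1) (h : n + j = i), e = h ▸ f.1 ⟨j, hj⟩) ∧ (n + L + 1 ≤ i → e = t.1 i) := by
    intro i
    by_cases h1 : i < n
    · exact ⟨x.1 i, fun _ => rfl, fun j hj h => by omega, fun h => by omega⟩
    · by_cases h2 : n + L + 1 ≤ i
      · exact ⟨t.1 i, fun h => by omega, fun j hj h => by omega, fun h => rfl⟩
      · obtain ⟨j, rfl⟩ : ∃ j, i = n + j := ⟨i - n, by omega⟩
        refine ⟨f.1 ⟨j, by omega⟩, fun h => by omega, fun j' hj' h => ?_, fun h => by omega⟩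
        have : j' = j := by omega
        subst this
        rfl
  choose e he1 he2 he3 using this
  have he2' : ∀ j (hj : j < L + 1), e (n + j) = f.1 ⟨j, hj⟩ := fun j hj => he2 _ j hj rfl
  refine ⟨⟨e, ?_⟩, he1, he2', he3⟩
  intro i
  rcases lt_trichotomy (i + 1) n with h | h | h
  · rw [he1 i (by omega), he1 (i + 1) h]
    exact x.2 i
  · subst h
    have h0 : e (i + 1) = f.1 ⟨0, by omega⟩ := he2' 0 (by omega)
    rw [he1 i (by omega), h0, hs, x.2 i]
    rfl
  · obtain ⟨j, rfl⟩ : ∃ j, i = n + j := ⟨i - n, by omega⟩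
    rcases lt_trichotomy j L with h' | h' | h'
    · have h1 : e (n + j + 1) = f.1 ⟨j + 1, by omega⟩ := he2' (j + 1) (by omega)
      rw [he2' j (by omega), h1]
      exact f.2 j h'
    · subst h'
      rw [he2' j (by omega), hr, he3 (n + j + 1) le_rfl]
      rfl
    · rw [he3 _ (by omega), he3 _ (by omega)]
      exact t.2 _

/-- segment of a path -/
def segOf (n L : ℕ) (z : B.Path) : B.Seg n L :=
  ⟨fun i => z.1 (n + i), fun i _ => z.2 (n + i)⟩

instance instFiniteSeg (n L : ℕ) : Finite (B.Seg n L) := by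
  unfold Seg
  infer_instance

theorem connect (hsimple : B.IsSimple) (n : ℕ) :
    ∃ m, n ≤ m ∧ ∀ x t : B.Path, ∃ z : B.Path, ag n x z ∧ ∀ i, m ≤ i → z.1 i = t.1 i := by
  obtain ⟨L, hL⟩ := hsimple n
  refine ⟨n + L + 1, by omega, fun x t => ?_⟩
  have h := hL (vtx n x) (vtx (n + L + 1) t)
  obtain ⟨⟨f, h1, h2⟩⟩ := (Nat.card_pos_iff.1 h).1
  obtain ⟨z, hz1, -, hz2⟩ := exists_join n L x t f h1 h2
  exact ⟨z, fun i hi => (hz1 i hi).symm, hz2⟩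

theorem pairing {T W : Type*} [Finite T] (π : T → W)
    (h : ∀ w, Even (Nat.card {t // π t = w})) :
    ∃ (σ : T → T) (col : T → Bool), (∀ t, σ (σ t) = t) ∧ (∀ t, π (σ t) = π t) ∧
      ∀ t, col (σ t) = !col t := by
  choose j hj using h
  have e : ∀ w, Nonempty ({t // π t = w} ≃ Fin (j w) × Bool) := by
    intro w
    apply Finite.card_eq.1
    rw [hj w]
    simp [mul_two]
  obtain ⟨Φ, hΦ⟩ : ∃ Φ : T ≃ Σ w, Fin (j w) × Bool, ∀ t, (Φ t).1 = π t :=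
    ⟨(Equiv.sigmaFiberEquiv π).symm.trans (Equiv.sigmaCongrRight fun w => (e w).some),
      fun t => rfl⟩
  obtain ⟨ρ, c, hρ1, hρ2, hρ3⟩ : ∃ (ρ : (Σ w, Fin (j w) × Bool) → Σ w, Fin (j w) × Bool)
      (c : (Σ w, Fin (j w) × Bool) → Bool), (∀ s, ρ (ρ s) = s) ∧ (∀ s, (ρ s).1 = s.1) ∧
      ∀ s, c (ρ s) = !c s := by
    refine ⟨fun s => ⟨s.1, (s.2.1, !s.2.2)⟩, fun s => s.2.2, ?_, fun s => rfl, fun s => rfl⟩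
    rintro ⟨w, a, b⟩
    simp
  refine ⟨fun t => Φ.symm (ρ (Φ t)), fun t => c (Φ t), ?_, ?_, ?_⟩
  · intro t
    simp [hρ1]
  · intro t
    rw [← hΦ, ← hΦ, Equiv.apply_symm_apply, hρ2]
  · intro t
    simp [hρ3]

theorem even_key (heven : B.IsEven) (n : ℕ) :
    ∃ m, n ≤ m ∧ ∃ (σ : B.Path → B.Path) (col : B.Path → Bool), Function.Involutive σ ∧
      (∀ z i, i < n ∨ m ≤ i → (σ z).1 i = z.1 i) ∧
      (∀ z z' : B.Path, (∀ i, n ≤ i → i < m → z.1 i = z'.1 i) →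
        (∀ i, n ≤ i → i < m → (σ z).1 i = (σ z').1 i) ∧ col z = col z') ∧
      ∀ z, col (σ z) = !col z := by
  obtain ⟨L, hL⟩ := heven n
  obtain ⟨σ, col, h1, h2, h3⟩ := pairing (T := B.Seg n L)
    (fun f => (B.src n (f.1 ⟨0, by omega⟩), B.rng (n + L) (f.1 ⟨L, by omega⟩))) (by
      rintro ⟨v, w⟩
      have := (hL v w).2
      unfold numPaths at this
      simpa only [Prod.mk.injEq] using this)
  have hz : ∀ z : B.Path, ∃ z' : B.Path, (∀ i, i < n → z'.1 i = z.1 i) ∧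
      (∀ i (hi : i < L + 1), z'.1 (n + i) = (σ (segOf n L z)).1 ⟨i, hi⟩) ∧
      ∀ i, n + L + 1 ≤ i → z'.1 i = z.1 i := by
    intro z
    have := h2 (segOf n L z)
    apply exists_join n L z z
    · exact congrArg Prod.fst this
    · refine (congrArg Prod.snd this).trans ?_
      exact z.2 (n + L)
  choose s hs1 hs2 hs3 using hz
  have hseg : ∀ z, segOf n L (s z) = σ (segOf n L z) := by
    intro z
    apply Subtype.ext
    funext i
    exact hs2 z i i.2
  have hsegeq : ∀ z z' : B.Path, (∀ i, n ≤ i → i < n + L + 1 → z.1 i = z'.1 i) →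
      segOf n L z = segOf n L z' := by
    intro z z' h
    apply Subtype.ext
    funext i
    exact h _ (by omega) (by omega)
  refine ⟨n + L + 1, by omega, s, fun z => col (segOf n L z), ?_, ?_, ?_, ?_⟩
  · intro z
    apply path_ext
    intro i
    by_cases hi : i < n
    · rw [hs1 _ i hi, hs1 _ i hi]
    · by_cases hi' : n + L + 1 ≤ i
      · rw [hs3 _ i hi', hs3 _ i hi']
      · obtain ⟨j, rfl⟩ : ∃ j, i = n + j := ⟨i - n, by omega⟩
        rw [hs2 _ j (by omega), hseg, h1]
        rfl
  · rintro z i (hi | hi)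
    · exact hs1 z i hi
    · exact hs3 z i hi
  · intro z z' h
    have hh := hsegeq z z' h
    refine ⟨?_, congrArg col hh⟩
    intro i hi hi'
    obtain ⟨j, rfl⟩ : ∃ j, i = n + j := ⟨i - n, by omega⟩
    rw [hs2 _ j (by omega), hs2 _ j (by omega), hh]
  · intro z
    simp only [hseg, h3]

instance instT2Path : T2Space B.Path :=
  inferInstanceAs (T2Space { x : ∀ i, B.E i // ∀ i, B.rng i (x i) = B.src (i + 1) (x (i + 1)) })

theorem compl_infinite (heven : B.IsEven) {A : Set B.Path} (hA : IsClopen A)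
    (hne : A ≠ Set.univ) : (Aᶜ).Infinite := by
  obtain ⟨x, hx⟩ := (Set.ne_univ_iff_exists_notMem A).1 hne
  have : (nhdsWithin x {x}ᶜ).NeBot := by
    rw [← mem_closure_iff_nhdsWithin_neBot, mem_closure_iff]
    intro U hU hxU
    obtain ⟨n, hn⟩ := exists_cyl hU hxU
    obtain ⟨m, _, σ, col, -, h2, -, h4⟩ := even_key heven n
    refine ⟨σ x, hn _ (fun i hi => (h2 x i (Or.inl hi)).symm), ?_⟩
    intro hcon
    have := h4 x
    rw [hcon] at this
    simp at this
  exact infinite_of_mem_nhds x (hA.compl.isOpen.mem_nhds hx)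

theorem exists_sep (F : Finset B.Path) :
    ∃ n, ∀ x ∈ F, ∀ y ∈ F, ag n x y → x = y := by
  have : ∀ p : B.Path × B.Path, ∃ n, ag n p.1 p.2 → p.1 = p.2 := by
    rintro ⟨x, y⟩
    by_contra hcon
    push Not at hcon
    exact (hcon 0).2 (path_ext fun i => (hcon (i + 1)).1 i (Nat.lt_succ_self i))
  choose f hf using this
  refine ⟨(F ×ˢ F).sup f, fun x hx y hy h => hf (x, y) (ag_mono ?_ h)⟩
  exact Finset.le_sup (f := f) (Finset.mk_mem_product hx hy)

theorem large (hsimple : B.IsSimple) (heven : B.IsEven) {A : Set B.Path} (hA : IsClopen A)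
    (hne : A ≠ Set.univ) (q : ℕ) :
    ∃ m0, ∀ m, m0 ≤ m → ∀ t : B.Path,
      q ≤ (pre m '' {z : B.Path | z ∉ A ∧ vtx m z = vtx m t}).ncard := by
  obtain ⟨F, hF, hFc⟩ := (compl_infinite heven hA hne).exists_subset_card_eq q
  obtain ⟨n1, hn1⟩ := exists_sep F
  obtain ⟨n2, hn2⟩ := exists_sat hA
  obtain ⟨m0, hm0, hc⟩ := connect hsimple (max n1 n2)
  refine ⟨m0, fun m hm t => ?_⟩
  choose z hz1 hz2 using fun x => hc x t
  rw [← hFc, ← Set.ncard_coe_finset]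
  apply Set.ncard_le_ncard_of_injOn (fun x => pre m (z x)) _ _ (Set.toFinite _)
  · intro x hx
    refine ⟨z x, ⟨fun k => hF hx (hn2 _ _ (ag_symm (ag_mono (le_max_right _ _) (hz1 x))) k), ?_⟩, rfl⟩
    unfold vtx
    rw [hz2 x m hm]
  · intro x hx y hy hxy
    have h1 := ag_mono (show n1 ≤ m by omega) (ag_iff_pre.2 hxy)
    exact hn1 x hx y hy (ag_trans (ag_mono (le_max_left _ _) (hz1 x))
      (ag_trans h1 (ag_symm (ag_mono (le_max_left _ _) (hz1 y)))))

/-- every vertex can be reached from the complement -/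
theorem reach (hsimple : B.IsSimple) {A : Set B.Path} (hA : IsClopen A)
    (hne : A ≠ Set.univ) :
    ∃ m0, ∀ m, m0 ≤ m → ∀ t : B.Path, ∃ z, z ∉ A ∧ vtx m z = vtx m t := by
  obtain ⟨x, hx⟩ := (Set.ne_univ_iff_exists_notMem A).1 hne
  obtain ⟨n2, hn2⟩ := exists_sat hA
  obtain ⟨m0, hm0, hc⟩ := connect hsimple n2
  refine ⟨m0, fun m hm t => ?_⟩
  obtain ⟨z, hz1, hz2⟩ := hc x t
  refine ⟨z, fun k => hx (hn2 _ _ (ag_symm hz1) k), ?_⟩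
  unfold vtx
  rw [hz2 m hm]

end BratteliDiagram
namespace BratteliDiagram

variable {B : BratteliDiagram}

theorem tau_mul_of_sep {m : ℕ} {a b c d : B.Path} (hab : vtx m a = vtx m b)
    (hcd : vtx m c = vtx m d) (h1 : ¬ ag m a c) (h2 : ¬ ag m b c) (h3 : ¬ ag m a d)
    (h4 : ¬ ag m b d) : tau m a b hab * tau m c d hcd = tau m c d hcd * tau m a b hab := by
  have hc := tau_else hab h1 h2
  have hd := tau_else hab h3 h4
  have := tau_conj hcd (tau_mem hab) (by rw [hc, hd]; exact hcd)
  have h5 : tau m (tau m a b hab • c) (tau m a b hab • d) (by rw [hc, hd]; exact hcd)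
      = tau m c d hcd := by
    apply tau_congr
    · rw [hc]
      exact ag_refl c
    · rw [hd]
      exact ag_refl d
  rw [h5] at this
  exact mul_inv_eq_iff_eq_mul.1 this

section noFinite

variable {A : Set B.Path} {Q : Type*} [Group Q] [Finite Q] {F : ↥B.fullGroup → Q}

theorem F_one
    (hF : ∀ a ∈ B.Gcirc A, ∀ b ∈ B.Gcirc A, F (a * b) = F a * F b) : F 1 = 1 := by
  have := hF 1 (one_mem _) 1 (one_mem _)
  rw [mul_one] at this
  exact left_eq_mul.1 this

theorem F_inv
    (hF : ∀ a ∈ B.Gcirc A, ∀ b ∈ B.Gcirc A, F (a * b) = F a * F b) {a : ↥B.fullGroup} (ha : a ∈ B.Gcirc A) : F a⁻¹ = (F a)⁻¹ := by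
  have := hF a ha _ (inv_mem ha)
  rw [mul_inv_cancel, F_one hF] at this
  exact eq_inv_of_mul_eq_one_right this.symm

theorem F_conj
    (hF : ∀ a ∈ B.Gcirc A, ∀ b ∈ B.Gcirc A, F (a * b) = F a * F b) {a b : ↥B.fullGroup} (ha : a ∈ B.Gcirc A) (hb : b ∈ B.Gcirc A) :
    F (a * b * a⁻¹) = F a * F b * (F a)⁻¹ := by
  rw [hF _ (mul_mem ha hb) _ (inv_mem ha), hF _ ha _ hb, F_inv hF ha]

theorem F_pigeon
    (hF : ∀ a ∈ B.Gcirc A, ∀ b ∈ B.Gcirc A, F (a * b) = F a * F b) {m : ℕ} (hA : Sat m A)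
    (hlarge : ∀ t : B.Path,
      Nat.card Q + 4 ≤ (pre m '' {z : B.Path | z ∉ A ∧ vtx m z = vtx m t}).ncard)
    {a b c : B.Path} (ha : a ∉ A) (hb : b ∉ A) (hc : c ∉ A) (hab : vtx m a = vtx m b)
    (hac : vtx m a = vtx m c) (nab : ¬ ag m a b) (nac : ¬ ag m a c) (nbc : ¬ ag m b c) :
    F (tau m a b hab) = F (tau m a c hac) := by
  set S := pre m '' {z : B.Path | z ∉ A ∧ vtx m z = vtx m a} with hS
  set T := S \ {pre m a, pre m b, pre m c} with hT
  have h3 : ({pre m a, pre m b, pre m c} : Set (∀ i : Fin m, B.E i)).ncard ≤ 3 := by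
    refine (Set.ncard_insert_le _ _).trans ?_
    have := Set.ncard_insert_le (pre m b) {pre m c}
    rw [Set.ncard_singleton] at this
    omega
  have hTc : Nat.card Q < Nat.card T := by
    have h1 := Set.le_ncard_sdiff {pre m a, pre m b, pre m c} S
    have h2 := hlarge a
    rw [← hS] at h2
    rw [← hT] at h1
    rw [Nat.card_coe_set_eq]
    omega
  have hrep : ∀ p : T, ∃ z : B.Path, z ∉ A ∧ vtx m a = vtx m z ∧ pre m z = p := by
    rintro ⟨p, ⟨z, ⟨hz1, hz2⟩, hz3⟩, -⟩
    exact ⟨z, hz1, hz2.symm, hz3⟩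
  choose z hz1 hz2 hz3 using hrep
  have hni : ¬ Function.Injective (fun p : T => F (tau m a (z p) (hz2 p))) := by
    intro hinj
    exact absurd (Nat.card_le_card_of_injective _ hinj) (not_le.2 hTc)
  rw [Function.Injective] at hni
  push Not at hni
  obtain ⟨p, p', hpp, hne⟩ := hni
  have sep : ∀ p : T, ¬ ag m (z p) a ∧ ¬ ag m (z p) b ∧ ¬ ag m (z p) c := by
    intro p
    have := p.2.2
    rw [← hz3 p] at this
    simp only [Set.mem_insert_iff, Set.mem_singleton_iff, not_or] at this
    simpa only [ag_iff_pre] using this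
  have nz : ¬ ag m (z p) (z p') := by
    intro k
    apply hne
    apply Subtype.ext
    rw [← hz3 p, ← hz3 p']
    exact ag_iff_pre.1 k
  have v1 : vtx m (z p) = vtx m b := (hz2 p).symm.trans hab
  have v2 : vtx m (z p') = vtx m c := (hz2 p').symm.trans hac
  have K1 := tau_mem_Gcirc hA v1 (hz1 p) hb
  have K2 := tau_mem_Gcirc hA v2 (hz1 p') hc
  have L1 := tau_mem v1
  have L2 := tau_mem v2
  set g := tau m (z p) b v1 * tau m (z p') c v2 with hg
  have Kg : g ∈ B.Gcirc A := mul_mem K1 K2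
  have Lg : g ∈ B.levelIn m := mul_mem L1 L2
  have e1 : g • a = a := by
    rw [hg, mul_smul, tau_else v2 (sep p').1 (fun k => nac (ag_symm k)),
      tau_else v1 (sep p).1 (fun k => nab (ag_symm k))]
  have e2 : ag m (g • z p) b := by
    rw [hg, mul_smul, tau_else v2 (fun k => nz (ag_symm k)) (fun k => (sep p).2.2 (ag_symm k))]
    exact ag_symm (tau_left v1 (ag_refl _))
  have e3 : ag m (g • z p') c := by
    have := ag_symm (tau_left v2 (ag_refl (z p')))
    rw [hg, mul_smul, tau_else v1]
    · exact this
    · exact fun k => (sep p).2.2 (ag_trans k this)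
    · exact fun k => nbc (ag_trans k this)
  have c1 := tau_conj (hz2 p) Lg (by rw [lev_vtx Lg, lev_vtx Lg]; exact hz2 p)
  have c2 := tau_conj (hz2 p') Lg (by rw [lev_vtx Lg, lev_vtx Lg]; exact hz2 p')
  rw [tau_congr _ hab (by rw [e1]; exact ag_refl a) e2] at c1
  rw [tau_congr _ hac (by rw [e1]; exact ag_refl a) e3] at c2
  rw [← c1, ← c2, F_conj hF Kg (tau_mem_Gcirc hA _ ha (hz1 p)),
    F_conj hF Kg (tau_mem_Gcirc hA _ ha (hz1 p'))]
  have hpp' : F (tau m a (z p) (hz2 p)) = F (tau m a (z p') (hz2 p')) := hpp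
  rw [hpp']

theorem F_comm1
    (hF : ∀ a ∈ B.Gcirc A, ∀ b ∈ B.Gcirc A, F (a * b) = F a * F b) {m : ℕ} (hA : Sat m A)
    (hlarge : ∀ t : B.Path,
      Nat.card Q + 4 ≤ (pre m '' {z : B.Path | z ∉ A ∧ vtx m z = vtx m t}).ncard)
    {a b c d : B.Path} (ha : a ∉ A) (hb : b ∉ A) (hd : d ∉ A) (hab : vtx m a = vtx m b)
    (hcd : vtx m c = vtx m d) (hac : ag m a c) :
    Commute (F (tau m a b hab)) (F (tau m c d hcd)) := by
  have had : vtx m a = vtx m d := (vtx_eq_of_ag hac).trans hcd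
  rw [tau_congr hcd had (ag_symm hac) (ag_refl d)]
  by_cases nab : ag m a b
  · rw [tau_self hab nab, F_one hF]
    exact Commute.one_left _
  by_cases nad : ag m a d
  · rw [tau_self had nad, F_one hF]
    exact Commute.one_right _
  by_cases nbd : ag m b d
  · rw [tau_congr hab had (ag_refl a) nbd]
  · rw [F_pigeon hF hA hlarge ha hb hd hab had nab nad nbd]

theorem F_comm
    (hF : ∀ a ∈ B.Gcirc A, ∀ b ∈ B.Gcirc A, F (a * b) = F a * F b) {m : ℕ} (hA : Sat m A)
    (hlarge : ∀ t : B.Path,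
      Nat.card Q + 4 ≤ (pre m '' {z : B.Path | z ∉ A ∧ vtx m z = vtx m t}).ncard)
    {a b c d : B.Path} (ha : a ∉ A) (hb : b ∉ A) (hc : c ∉ A) (hd : d ∉ A)
    (hab : vtx m a = vtx m b) (hcd : vtx m c = vtx m d) :
    Commute (F (tau m a b hab)) (F (tau m c d hcd)) := by
  by_cases h1 : ag m a c
  · exact F_comm1 hF hA hlarge ha hb hd hab hcd h1
  by_cases h2 : ag m a d
  · rw [tau_symm hcd]
    exact F_comm1 hF hA hlarge ha hb hc hab hcd.symm h2
  by_cases h3 : ag m b c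
  · rw [tau_symm hab]
    exact F_comm1 hF hA hlarge hb ha hd hab.symm hcd h3
  by_cases h4 : ag m b d
  · rw [tau_symm hab, tau_symm hcd]
    exact F_comm1 hF hA hlarge hb ha hc hab.symm hcd.symm h4
  · have := tau_mul_of_sep hab hcd h1 h3 h2 h4
    have k1 := tau_mem_Gcirc hA hab ha hb
    have k2 := tau_mem_Gcirc hA hcd hc hd
    rw [commute_iff_eq, ← hF _ k1 _ k2, ← hF _ k2 _ k1, this]

/-- elements of `Gcirc A` whose `F`-image commutes with `q` -/
def centK (hF : ∀ a ∈ B.Gcirc A, ∀ b ∈ B.Gcirc A, F (a * b) = F a * F b) (q : Q) :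
    Subgroup ↥B.fullGroup where
  carrier := {g | g ∈ B.Gcirc A ∧ Commute (F g) q}
  one_mem' := ⟨one_mem _, by rw [F_one hF]; exact Commute.one_left _⟩
  mul_mem' := by
    rintro a b ⟨ha, ha'⟩ ⟨hb, hb'⟩
    refine ⟨mul_mem ha hb, ?_⟩
    rw [hF a ha b hb]
    exact ha'.mul_left hb'
  inv_mem' := by
    rintro a ⟨ha, ha'⟩
    refine ⟨inv_mem ha, ?_⟩
    rw [F_inv hF ha]
    exact ha'.inv_left

theorem F_comm_all
    (hF : ∀ a ∈ B.Gcirc A, ∀ b ∈ B.Gcirc A, F (a * b) = F a * F b) (hsimple : B.IsSimple) (heven : B.IsEven) (hA : IsClopen A)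
    (hne : A ≠ Set.univ) {g h : ↥B.fullGroup} (hg : g ∈ B.Gcirc A) (hh : h ∈ B.Gcirc A) :
    Commute (F g) (F h) := by
  obtain ⟨m1, h1⟩ := large hsimple heven hA hne (Nat.card Q + 4)
  obtain ⟨m2, h2⟩ := exists_sat hA
  obtain ⟨m3, h3⟩ := exists_lev g
  obtain ⟨m4, h4⟩ := exists_lev h
  set m := max (max m1 m2) (max m3 m4) with hm
  have hS : Sat m A := h2.mono (by omega)
  have hl := h1 m (by omega)
  have g1 := mem_closure_tau g (lev_mono (show m3 ≤ m by omega) h3) hg hS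
  have g2 := mem_closure_tau h (lev_mono (show m4 ≤ m by omega) h4) hh hS
  have step1 : ∀ c d : B.Path, ∀ hcd : vtx m c = vtx m d, c ∉ A → d ∉ A →
      Commute (F g) (F (tau m c d hcd)) := by
    intro c d hcd hc hd
    have : Subgroup.closure (tauSet m A) ≤ centK hF (F (tau m c d hcd)) := by
      rw [Subgroup.closure_le]
      rintro _ ⟨a, b, hab, ha, hb, rfl⟩
      exact ⟨tau_mem_Gcirc hS hab ha hb, F_comm hF hS hl ha hb hc hd hab hcd⟩
    exact (this g1).2
  have : Subgroup.closure (tauSet m A) ≤ centK hF (F g) := by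
    rw [Subgroup.closure_le]
    rintro _ ⟨a, b, hab, ha, hb, rfl⟩
    exact ⟨tau_mem_Gcirc hS hab ha hb, (step1 a b hab ha hb).symm⟩
  exact (this g2).2.symm

theorem F_invol
    (hF : ∀ a ∈ B.Gcirc A, ∀ b ∈ B.Gcirc A, F (a * b) = F a * F b) (hsimple : B.IsSimple) (heven : B.IsEven) (hA : IsClopen A)
    (hne : A ≠ Set.univ) {g : ↥B.fullGroup} (hg : g ∈ B.Gcirc A) (hg2 : g * g = 1) :
    F g = 1 := by
  classical
  obtain ⟨m1, hS0⟩ := exists_sat hA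
  obtain ⟨m2, h2⟩ := exists_lev g
  set n := max m1 m2 with hn
  have hS : Sat n A := hS0.mono (by omega)
  have hgn : g ∈ B.levelIn n := lev_mono (by omega) h2
  obtain ⟨m, hnm, σ, col, s1, s2, s3, s4⟩ := even_key heven n
  have hgg : ∀ z : B.Path, g • g • z = z := by
    intro z
    rw [← mul_smul, hg2, one_smul]
  have hgA : ∀ z : B.Path, z ∈ A → g • z = z := mem_Gcirc.1 hg
  have hcolg : ∀ z : B.Path, col (g • z) = col z := by
    intro z
    exact (s3 _ _ fun i hi _ => lev_tail hgn z i hi).2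
  have hσn : ∀ z : B.Path, ag n z (σ z) := fun z i hi => (s2 z i (Or.inl hi)).symm
  have hσA : ∀ z : B.Path, σ z ∈ A ↔ z ∈ A :=
    fun z => ⟨hS _ _ (ag_symm (hσn z)), hS _ _ (hσn z)⟩
  have hcomm : ∀ z : B.Path, σ (g • z) = g • σ z := by
    intro z
    apply eq_of_ag_of_tail (m := n)
    · exact ag_trans (ag_symm (hσn _)) (lev_ag hgn (hσn z))
    · intro i hi
      rw [lev_tail hgn _ i hi]
      rcases lt_or_ge i m with h | h
      · exact (s3 _ _ fun i hi _ => lev_tail hgn z i hi).1 i hi h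
      · rw [s2 _ i (Or.inr h), s2 _ i (Or.inr h), lev_tail hgn z i hi]
  let hf : B.Path → B.Path := fun z => if col z = true then g • z else z
  let sf : B.Path → B.Path := fun z => if z ∈ A then z else σ z
  have hgm : g ∈ B.levelIn m := lev_mono hnm hgn
  let h : ↥B.fullGroup := mkInvol m hf (by
      intro z
      by_cases hc : col z = true
      · simp [hf, hc, hcolg, hgg]
      · simp [hf, hc]) (by
      intro z i hi
      simp only [hf]
      split_ifs
      · exact lev_tail hgm z i hi
      · rfl) (by
      intro z w hzw
      have : col z = col w := (s3 z w fun i _ hi => hzw i hi).2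
      simp only [hf, this]
      split_ifs
      · exact lev_ag hgm hzw
      · exact hzw)
  let s : ↥B.fullGroup := mkInvol m sf (by
      intro z
      by_cases hc : z ∈ A
      · simp [sf, hc]
      · simp [sf, hc, hσA, s1 z]) (by
      intro z i hi
      simp only [sf]
      split_ifs
      · rfl
      · exact s2 z i (Or.inr hi)) (by
      intro z w hzw
      have hSm := hS.mono hnm
      have : z ∈ A ↔ w ∈ A := ⟨hSm _ _ hzw, hSm _ _ (ag_symm hzw)⟩
      simp only [sf, this]
      split_ifs
      · exact hzw
      · intro i hi
        rcases lt_or_ge i n with h | h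
        · rw [s2 z i (Or.inl h), s2 w i (Or.inl h), hzw i hi]
        · exact (s3 z w fun i _ hi => hzw i hi).1 i h hi)
  have hsmul : ∀ z : B.Path, h • z = if col z = true then g • z else z := fun z => rfl
  have ssmul : ∀ z : B.Path, s • z = if z ∈ A then z else σ z := fun z => rfl
  have hK : h ∈ B.Gcirc A := by
    rw [mem_Gcirc]
    intro z hz
    rw [hsmul, hgA z hz, ite_self]
  have sK : s ∈ B.Gcirc A := by
    rw [mem_Gcirc]
    intro z hz
    rw [ssmul, if_pos hz]
  have hh : h * h = 1 := by
    apply G_ext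
    intro z
    rw [mul_smul, one_smul]
    by_cases hc : col z = true
    · simp [hsmul, hc, hcolg, hgg]
    · simp [hsmul, hc]
  have ss : s * s = 1 := by
    apply G_ext
    intro z
    rw [mul_smul, one_smul]
    by_cases hc : z ∈ A
    · simp [ssmul, hc]
    · simp [ssmul, hc, hσA, s1 z]
  have hgA' : ∀ z : B.Path, z ∉ A → g • z ∉ A := by
    intro z hz k
    have := hgA _ k
    rw [hgg] at this
    exact hz (this ▸ k)
  have hdec : g = h * (s * h * s) := by
    apply G_ext
    intro z
    rw [mul_smul, mul_smul, mul_smul]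
    by_cases hz : z ∈ A
    · rw [mem_Gcirc.1 sK z hz, mem_Gcirc.1 hK z hz, mem_Gcirc.1 sK z hz, mem_Gcirc.1 hK z hz,
        hgA z hz]
    · have e1 : s • z = σ z := by rw [ssmul, if_neg hz]
      have hσz : σ z ∉ A := fun k => hz ((hσA z).1 k)
      rw [e1]
      by_cases hc : col z = true
      · have e2 : h • σ z = σ z := by
          rw [hsmul, s4, hc]
          simp
        have e3 : s • σ z = z := by rw [ssmul, if_neg hσz, s1 z]
        rw [e2, e3, hsmul, if_pos hc]
      · have e2 : h • σ z = σ (g • z) := by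
          rw [hsmul, s4, hcomm]
          simp [hc]
        have e3 : s • σ (g • z) = g • z := by
          rw [ssmul, if_neg, s1]
          rw [hσA]
          exact hgA' z hz
        rw [e2, e3, hsmul, hcolg, if_neg hc]
  have sinv : s⁻¹ = s := inv_eq_of_mul_eq_one_left ss
  have h1 : F g = F h * (F s * F h * (F s)⁻¹) := by
    have hd : g = h * (s * h * s⁻¹) := by
      rw [sinv]
      exact hdec
    have := hF _ hK _ (mul_mem (mul_mem sK hK) (inv_mem sK))
    rw [← hd, F_conj hF sK hK] at this
    exact this
  rw [h1, (F_comm_all hF hsimple heven hA hne sK hK).eq, mul_inv_cancel_right, ← hF _ hK _ hK, hh,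
    F_one hF]

theorem F_trivial
    (hF : ∀ a ∈ B.Gcirc A, ∀ b ∈ B.Gcirc A, F (a * b) = F a * F b) (hsimple : B.IsSimple) (heven : B.IsEven) (hA : IsClopen A)
    (hne : A ≠ Set.univ) {g : ↥B.fullGroup} (hg : g ∈ B.Gcirc A) : F g = 1 := by
  obtain ⟨m1, hS0⟩ := exists_sat hA
  obtain ⟨m2, h2⟩ := exists_lev g
  set n := max m1 m2 with hn
  have hS : Sat n A := hS0.mono (by omega)
  have hgn : g ∈ B.levelIn n := lev_mono (by omega) h2
  have hmem := mem_closure_tau g hgn hg hS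
  have : g ∈ B.Gcirc A ∧ F g = 1 := by
    refine Subgroup.closure_induction (p := fun x _ => x ∈ B.Gcirc A ∧ F x = 1) ?_ ?_ ?_ ?_ hmem
    · rintro _ ⟨a, b, hab, ha, hb, rfl⟩
      have := tau_mem_Gcirc hS hab ha hb
      exact ⟨this, F_invol hF hsimple heven hA hne this (tau_sq hab)⟩
    · exact ⟨one_mem _, F_one hF⟩
    · rintro x y _ _ ⟨hx, hx'⟩ ⟨hy, hy'⟩
      exact ⟨mul_mem hx hy, by rw [hF x hx y hy, hx', hy', mul_one]⟩
    · rintro x _ ⟨hx, hx'⟩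
      exact ⟨inv_mem hx, by rw [F_inv hF hx, hx', inv_one]⟩
  exact this.2

end noFinite

/-- `Gcirc A` has no proper finite index subgroups -/
theorem le_of_relIndex (hsimple : B.IsSimple) (heven : B.IsEven) {A : Set B.Path}
    (hA : IsClopen A) (hne : A ≠ Set.univ) (N : Subgroup ↥B.fullGroup)
    (hN : N.relIndex (B.Gcirc A) ≠ 0) : B.Gcirc A ≤ N := by
  classical
  set K := B.Gcirc A with hK
  have hfin : Finite (↥K ⧸ N.subgroupOf K) := Nat.finite_of_card_ne_zero hN
  let f : ↥K →* Equiv.Perm (↥K ⧸ N.subgroupOf K) := MulAction.toPermHom _ _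
  let F : ↥B.fullGroup → Equiv.Perm (↥K ⧸ N.subgroupOf K) :=
    fun g => if h : g ∈ K then f ⟨g, h⟩ else 1
  have hF : ∀ a ∈ B.Gcirc A, ∀ b ∈ B.Gcirc A, F (a * b) = F a * F b := by
    intro a ha b hb
    simp only [F]
    rw [dif_pos (mul_mem ha hb), dif_pos ha, dif_pos hb, ← map_mul]
    rfl
  intro g hg
  have h1 := F_trivial hF hsimple heven hA hne hg
  simp only [F] at h1
  rw [dif_pos hg] at h1
  have h2 := congrArg (fun p => p ((1 : ↥K) : ↥K ⧸ N.subgroupOf K)) h1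
  have h3 : (((⟨g, hg⟩ : ↥K) * 1 : ↥K) : ↥K ⧸ N.subgroupOf K) = ((1 : ↥K) : ↥K ⧸ N.subgroupOf K) := h2
  rw [mul_one, eq_comm, QuotientGroup.eq] at h3
  simpa [Subgroup.mem_subgroupOf] using h3

theorem orbit_infinite (hsimple : B.IsSimple) (heven : B.IsEven) {A : Set B.Path}
    (hA : IsClopen A) (hne : A ≠ Set.univ) {x : B.Path} (hx : x ∉ A)
    (N : Subgroup ↥B.fullGroup) (hN : N ≤ MulAction.stabilizer ↥B.fullGroup x) :
    N.relIndex (B.Gcirc A) = 0 := by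
  by_contra hcon
  have hle := (le_of_relIndex hsimple heven hA hne N hcon).trans hN
  obtain ⟨m1, h1⟩ := large hsimple heven hA hne 2
  obtain ⟨m2, h2⟩ := exists_sat hA
  set m := max m1 m2 with hm
  have hS : Sat m A := h2.mono (by omega)
  have hc := h1 m (by omega) x
  obtain ⟨p, hp, hpx⟩ := Set.exists_ne_of_one_lt_ncard hc (pre m x)
  obtain ⟨z, ⟨hz1, hz2⟩, rfl⟩ := hp
  have := hle (tau_mem_Gcirc hS hz2.symm hx hz1)
  rw [MulAction.mem_stabilizer_iff] at this
  have h3 := tau_left hz2.symm (ag_refl x)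
  rw [this] at h3
  exact hpx (ag_iff_pre.1 h3)

/-- generation -/
theorem Gcirc_inter_le (hsimple : B.IsSimple) {A C : Set B.Path}
    (hA : IsClopen A) (hC : IsClopen C) (hne : A ∪ C ≠ Set.univ) :
    B.Gcirc (A ∩ C) ≤ B.Gcirc A ⊔ B.Gcirc C := by
  intro g hg
  obtain ⟨m1, hS1⟩ := exists_sat hA
  obtain ⟨m2, hS2⟩ := exists_sat hC
  obtain ⟨m3, h3⟩ := exists_lev g
  obtain ⟨m4, h4⟩ := reach hsimple (hA.union hC) hne
  set m := max (max m1 m2) (max m3 m4) with hm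
  have SA : Sat m A := hS1.mono (by omega)
  have SC : Sat m C := hS2.mono (by omega)
  have SAC : Sat m (A ∩ C) := fun x y hxy hx => ⟨SA _ _ hxy hx.1, SC _ _ hxy hx.2⟩
  have hgm : g ∈ B.levelIn m := lev_mono (by omega) h3
  have hmem := mem_closure_tau g hgm hg SAC
  have main : ∀ x y : B.Path, ∀ h : vtx m x = vtx m y, x ∉ A → x ∈ C → y ∈ A → y ∉ C →
      tau m x y h ∈ B.Gcirc A ⊔ B.Gcirc C := by
    intro x y h hxA hxC hyA hyC
    obtain ⟨w, hw, hwv⟩ := h4 m (by omega) x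
    rw [Set.mem_union, not_or] at hw
    have t1 := tau_mem_Gcirc SA hwv hw.1 hxA
    have t2 := tau_mem_Gcirc SC (hwv.trans h) hw.2 hyC
    have L := tau_mem hwv
    have e1 : ag m (tau m w x hwv • w) x := ag_symm (tau_left hwv (ag_refl w))
    have e2 : tau m w x hwv • y = y := tau_else hwv
      (fun k => hw.1 (SA _ _ (ag_symm k) hyA)) (fun k => hxA (SA _ _ (ag_symm k) hyA))
    have c := tau_conj (hwv.trans h) L (by rw [lev_vtx L, lev_vtx L]; exact hwv.trans h)
    rw [tau_congr _ h e1 (by rw [e2]; exact ag_refl y)] at c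
    rw [← c]
    have t1' : tau m w x hwv ∈ B.Gcirc A ⊔ B.Gcirc C := (le_sup_left : B.Gcirc A ≤ _) t1
    have t2' := (le_sup_right : B.Gcirc C ≤ B.Gcirc A ⊔ B.Gcirc C) t2
    exact mul_mem (mul_mem t1' t2') (inv_mem t1')
  have hle : Subgroup.closure (tauSet m (A ∩ C)) ≤ B.Gcirc A ⊔ B.Gcirc C := by
    rw [Subgroup.closure_le]
    rintro _ ⟨x, y, h, hx, hy, rfl⟩
    by_cases hA1 : x ∉ A ∧ y ∉ A
    · exact (le_sup_left : B.Gcirc A ≤ _) (tau_mem_Gcirc SA h hA1.1 hA1.2)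
    by_cases hC1 : x ∉ C ∧ y ∉ C
    · exact (le_sup_right : B.Gcirc C ≤ B.Gcirc A ⊔ B.Gcirc C) (tau_mem_Gcirc SC h hC1.1 hC1.2)
    by_cases hxA : x ∈ A
    · have hxC : x ∉ C := fun k => hx ⟨hxA, k⟩
      have hyC : y ∈ C := by tauto
      have hyA : y ∉ A := fun k => hy ⟨k, hyC⟩
      rw [tau_symm h]
      exact main y x h.symm hyA hyC hxA hxC
    · have hyA : y ∈ A := by tauto
      have hyC : y ∉ C := fun k => hy ⟨hyA, k⟩
      have hxC : x ∈ C := by tauto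
      exact main x y h hxA hxC hyA hyC
  exact hle hmem

theorem Gcirc_anti {A C : Set B.Path} (h : A ⊆ C) : B.Gcirc C ≤ B.Gcirc A := by
  intro g hg
  rw [mem_Gcirc] at hg ⊢
  exact fun x hx => hg x (h hx)

theorem conjSub_one {Γ : Type*} [Group Γ] (H : Subgroup Γ) : conjSub 1 H = H := by
  ext x
  simp [conjSub, Subgroup.mem_map]

theorem conjSub_mul {Γ : Type*} [Group Γ] (a b : Γ) (H : Subgroup Γ) :
    conjSub (a * b) H = conjSub a (conjSub b H) := by
  simp only [conjSub, Subgroup.map_map]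
  congr 1
  ext x
  simp [mul_assoc]

/-- normalizer of `H` -/
def nrm {Γ : Type*} [Group Γ] (H : Subgroup Γ) : Subgroup Γ where
  carrier := {g | conjSub g H = H}
  one_mem' := conjSub_one H
  mul_mem' := by
    intro a b ha hb
    change conjSub (a * b) H = H
    rw [conjSub_mul, hb, ha]
  inv_mem' := by
    intro a ha
    change conjSub a⁻¹ H = H
    conv_lhs => rw [← (show conjSub a H = H from ha)]
    rw [← conjSub_mul, inv_mul_cancel, conjSub_one]

theorem mem_FF {A : Set B.Path} {H : Subgroup ↥B.fullGroup} : H ∈ B.FF A ↔ B.Gcirc A ≤ nrm H :=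
  Iff.rfl

theorem FF_inter (hsimple : B.IsSimple) {A C : Set B.Path}
    (hA : IsClopen A) (hC : IsClopen C) (hne : A ∪ C ≠ Set.univ) :
    B.FF A ∩ B.FF C = B.FF (A ∩ C) := by
  ext H
  rw [Set.mem_inter_iff, mem_FF, mem_FF, mem_FF]
  constructor
  · rintro ⟨h1, h2⟩
    exact (Gcirc_inter_le hsimple hA hC hne).trans (sup_le h1 h2)
  · intro h
    exact ⟨(Gcirc_anti Set.inter_subset_left).trans h, (Gcirc_anti Set.inter_subset_right).trans h⟩

end BratteliDiagram
namespace BratteliDiagram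

variable {B : BratteliDiagram}

theorem levelIn_finite (n : ℕ) : Finite ↥(B.levelIn n) := by
  classical
  by_cases hX : Nonempty B.Path
  · obtain ⟨x0⟩ := hX
    let rep : (∀ i : Fin n, B.E i) → B.Path := fun p =>
      if h : ∃ z, pre n z = p then h.choose else x0
    have hrep : ∀ z : B.Path, ag n z (rep (pre n z)) := by
      intro z
      have h : ∃ w : B.Path, pre n w = pre n z := ⟨z, rfl⟩
      simp only [rep]
      rw [dif_pos h]
      exact ag_iff_pre.2 h.choose_spec.symm
    apply Finite.of_injective (fun (g : ↥(B.levelIn n)) (p : ∀ i : Fin n, B.E i) =>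
      pre n ((g : ↥B.fullGroup) • rep p))
    intro g h hgh
    apply Subtype.ext
    apply G_ext
    intro z
    apply eq_of_ag_of_tail (m := n)
    · have := congrFun hgh (pre n z)
      exact ag_trans (lev_ag g.2 (hrep z)) (ag_trans (ag_iff_pre.2 this)
        (ag_symm (lev_ag h.2 (hrep z))))
    · intro i hi
      rw [lev_tail g.2 z i hi, lev_tail h.2 z i hi]
  · have : Subsingleton ↥(B.levelIn n) :=
      ⟨fun g h => Subtype.ext (G_ext fun x => (hX ⟨x⟩).elim)⟩
    infer_instance

instance instCountableG : Countable ↥B.fullGroup := by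
  have : (Set.univ : Set ↥B.fullGroup) = ⋃ n, (B.levelIn n : Set ↥B.fullGroup) := by
    symm
    rw [Set.eq_univ_iff_forall]
    intro g
    rw [Set.mem_iUnion]
    exact exists_lev g
  rw [← Set.countable_univ_iff, this]
  apply Set.countable_iUnion
  intro n
  have := levelIn_finite (B := B) n
  exact (Set.toFinite _).countable

instance instFiniteGcircN (n : ℕ) (A : Set B.Path) : Finite ↥(B.GcircN n A) := by
  have := levelIn_finite (B := B) n
  have h : B.GcircN n A ≤ B.levelIn n := inf_le_left
  exact Finite.of_injective _ (Subgroup.inclusion_injective h)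

theorem GcircN_mono (A : Set B.Path) : Monotone fun n => B.GcircN n A :=
  fun _ _ h => inf_le_inf_right _ (lev_mono h)

theorem exists_GcircN {A : Set B.Path} {g : ↥B.fullGroup} (hg : g ∈ B.Gcirc A) :
    ∃ n, g ∈ B.GcircN n A := by
  obtain ⟨n, hn⟩ := exists_lev g
  exact ⟨n, hn, hg⟩

end BratteliDiagram

section avg

variable {Γ : Type*} [Group Γ]

open Classical in
/-- proportion of `N` in a finite subgroup `L` -/
def prop (L N : Subgroup Γ) : ℝ≥0∞ :=
  (∑ᶠ g : ↥L, if (g : Γ) ∈ N then (1 : ℝ≥0∞) else 0) / (Nat.card ↥L : ℝ≥0∞)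

theorem prop_eq (L N : Subgroup Γ) [Finite ↥L] :
    prop L N = ((N.relIndex L : ℕ) : ℝ≥0∞)⁻¹ := by
  classical
  have := Fintype.ofFinite ↥L
  have h1 : (∑ᶠ g : ↥L, if (g : Γ) ∈ N then (1 : ℝ≥0∞) else 0)
      = (Nat.card ↥(N.subgroupOf L) : ℝ≥0∞) := by
    rw [finsum_eq_sum_of_fintype, Finset.sum_boole]
    have : Nat.card ↥(N.subgroupOf L) = Fintype.card {g : ↥L // (g : Γ) ∈ N} := by
      rw [← Nat.card_eq_fintype_card]
      rfl
    rw [this, Fintype.card_subtype]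
  have h2 : Nat.card ↥(N.subgroupOf L) * N.relIndex L = Nat.card ↥L :=
    Subgroup.card_mul_index _
  unfold prop
  rw [h1, ← h2, Nat.cast_mul]
  have h3 : (Nat.card ↥(N.subgroupOf L) : ℝ≥0∞) ≠ 0 := by
    exact_mod_cast Nat.card_pos.ne'
  rw [ENNReal.div_eq_inv_mul, ENNReal.mul_inv (Or.inl h3) (Or.inl (ENNReal.natCast_ne_top _)),
    mul_comm, ← mul_assoc, ENNReal.mul_inv_cancel h3 (ENNReal.natCast_ne_top _), one_mul]

theorem prop_le_one (L N : Subgroup Γ) [Finite ↥L] : prop L N ≤ 1 := by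
  rw [prop_eq, ENNReal.inv_le_one]
  have : N.relIndex L ≠ 0 := by
    unfold Subgroup.relIndex
    exact Subgroup.index_ne_zero_of_finite
  exact_mod_cast Nat.one_le_iff_ne_zero.2 this

variable {K : Subgroup Γ} {L : ℕ → Subgroup Γ} [∀ n, Finite ↥(L n)]

theorem prop_tendsto_one {N : Subgroup Γ} (hLK : ∀ n, L n ≤ K) (hN : K ≤ N) :
    Tendsto (fun n => prop (L n) N) atTop (nhds 1) := by
  have : ∀ n, prop (L n) N = 1 := by
    intro n
    rw [prop_eq, Subgroup.relIndex_eq_one.2 ((hLK n).trans hN)]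
    simp
  simp [this]

theorem prop_tendsto_zero {N : Subgroup Γ} (hL : Monotone L)
    (hex : ∀ g ∈ K, ∃ n, g ∈ L n) (hN : N.relIndex K = 0) :
    Tendsto (fun n => prop (L n) N) atTop (nhds 0) := by
  simp only [prop_eq]
  rw [ENNReal.tendsto_inv_iff.symm]
  simp only [inv_inv, ENNReal.inv_zero]
  apply ENNReal.tendsto_nat_nhds_top.comp
  rw [tendsto_atTop]
  intro q
  have hinf : Infinite (↥K ⧸ N.subgroupOf K) := Subgroup.index_eq_zero_iff_infinite.1 hN
  obtain ⟨F, hF⟩ := Infinite.exists_subset_card_eq (↥K ⧸ N.subgroupOf K) q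
  choose ν hν using hex
  let f : (↥K ⧸ N.subgroupOf K) → ℕ := fun c => ν c.out c.out.2
  rw [eventually_atTop]
  refine ⟨F.sup f, fun n hn => ?_⟩
  have hmem : ∀ c ∈ F, (c.out : Γ) ∈ L n := by
    intro c hc
    exact hL ((Finset.le_sup (f := f) hc).trans hn) (hν _ c.out.2)
  rw [← hF]
  unfold Subgroup.relIndex Subgroup.index
  have hcard : F.card = Nat.card F := by simp
  rw [hcard]
  apply Nat.card_le_card_of_injective
    (fun c : F => ((⟨(c.1.out : Γ), hmem c.1 c.2⟩ : ↥(L n)) : ↥(L n) ⧸ N.subgroupOf (L n)))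
  intro c d hcd
  apply Subtype.ext
  rw [QuotientGroup.eq] at hcd
  rw [← Quotient.out_eq' c.1, ← Quotient.out_eq' d.1]
  apply QuotientGroup.eq.2
  exact hcd

theorem avg_tendsto [Countable Γ] (hLK : ∀ n, L n ≤ K) (hL : Monotone L)
    (hex : ∀ g ∈ K, ∃ n, g ∈ L n) {Y : Type*} [MeasurableSpace Y] (ν : Measure Y)
    [IsFiniteMeasure ν] (N : Y → Subgroup Γ) (hmeas : ∀ g, MeasurableSet {y | g ∈ N y})
    (hdich : ∀ y, K ≤ N y ∨ (N y).relIndex K = 0) :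
    Tendsto (fun n => (∑ᶠ g : ↥(L n), ν {y | (g : Γ) ∈ N y}) / (Nat.card ↥(L n) : ℝ≥0∞)) atTop
      (nhds (ν {y | K ≤ N y})) := by
  classical
  have hS : MeasurableSet {y | K ≤ N y} := by
    have : {y | K ≤ N y} = ⋂ g ∈ (K : Set Γ), {y | g ∈ N y} := by
      ext y
      simp [SetLike.le_def]
    rw [this]
    exact MeasurableSet.biInter (Set.to_countable _) fun g _ => hmeas g
  have hterm : ∀ g : Γ, Measurable fun y => if g ∈ N y then (1 : ℝ≥0∞) else 0 := by
    intro g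
    exact Measurable.ite (hmeas g) measurable_const measurable_const
  have hpm : ∀ n, Measurable fun y => prop (L n) (N y) := by
    intro n
    have := Fintype.ofFinite ↥(L n)
    have hsm : Measurable fun y => ∑ g : ↥(L n), if (g : Γ) ∈ N y then (1 : ℝ≥0∞) else 0 :=
      Finset.measurable_sum Finset.univ (fun g _ => hterm (g : Γ))
    unfold prop
    simp only [finsum_eq_sum_of_fintype]
    exact hsm.div_const _
  have hintg : ∀ n, ∫⁻ y, prop (L n) (N y) ∂ν
      = (∑ᶠ g : ↥(L n), ν {y | (g : Γ) ∈ N y}) / (Nat.card ↥(L n) : ℝ≥0∞) := by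
    intro n
    have := Fintype.ofFinite ↥(L n)
    have hsm : Measurable fun y => ∑ g : ↥(L n), if (g : Γ) ∈ N y then (1 : ℝ≥0∞) else 0 :=
      Finset.measurable_sum Finset.univ (fun g _ => hterm (g : Γ))
    unfold prop
    simp only [finsum_eq_sum_of_fintype, div_eq_mul_inv]
    rw [lintegral_mul_const _ hsm,
      lintegral_finsetSum Finset.univ (fun (g : ↥(L n)) _ => hterm (g : Γ))]
    congr 1
    apply Finset.sum_congr rfl
    intro g _
    rw [← lintegral_indicator_one (hmeas g)]
    rfl
  have hlim := tendsto_lintegral_of_dominated_convergence (μ := ν)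
    (F := fun n y => prop (L n) (N y)) (f := {y | K ≤ N y}.indicator 1) (fun _ => 1) hpm
    (fun n => Eventually.of_forall fun y => prop_le_one _ _)
    (by simp) (Eventually.of_forall fun y => by
      by_cases h : K ≤ N y
      · rw [Set.indicator_of_mem (show y ∈ {y | K ≤ N y} from h)]
        exact prop_tendsto_one hLK h
      · rw [Set.indicator_of_notMem (show y ∉ {y | K ≤ N y} from h)]
        exact prop_tendsto_zero hL hex ((hdich y).resolve_left h))
  rw [lintegral_indicator_one hS] at hlim
  simpa only [hintg] using hlim

end avg

theorem tsum_tendsto {I : Type*} [Countable I] {f : ℕ → I → ℝ≥0∞} {g b : I → ℝ≥0∞}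
    (hb : ∑' i, b i ≠ ⊤) (hfb : ∀ n i, f n i ≤ b i)
    (hlim : ∀ i, Tendsto (fun n => f n i) atTop (nhds (g i))) :
    Tendsto (fun n => ∑' i, f n i) atTop (nhds (∑' i, g i)) := by
  letI : MeasurableSpace I := ⊤
  have := tendsto_lintegral_of_dominated_convergence (μ := Measure.count) (F := f) (f := g) b
    (fun n => measurable_from_top) (fun n => Eventually.of_forall (hfb n))
    (by rwa [lintegral_count]) (Eventually.of_forall hlim)
  simpa only [lintegral_count] using this

theorem measurable_mem_sub {Γ : Type*} [Group Γ] (a : Γ) :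
    MeasurableSet {H : Subgroup Γ | a ∈ H} := by
  have h1 : Measurable (fun H : Subgroup Γ => (H : Set Γ)) := comap_measurable _
  exact measurableSet_setOf.2 ((measurable_set_mem a).comp h1)

theorem measurable_nrm {Γ : Type*} [Group Γ] [Countable Γ] (g : Γ) :
    MeasurableSet {H : Subgroup Γ | conjSub g H = H} := by
  have : {H : Subgroup Γ | conjSub g H = H}
      = ⋂ a : Γ, {H : Subgroup Γ | (g⁻¹ * a * g ∈ H) ↔ a ∈ H} := by
    ext H
    have key : ∀ a, a ∈ conjSub g H ↔ g⁻¹ * a * g ∈ H := by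
      intro a
      unfold conjSub
      rw [Subgroup.mem_map]
      constructor
      · rintro ⟨b, hb, rfl⟩
        simpa [mul_assoc] using hb
      · intro h
        exact ⟨_, h, by simp [mul_assoc]⟩
    simp only [Set.mem_iInter, Set.mem_setOf_eq]
    constructor
    · intro h a
      rw [← key, h]
    · intro h
      ext a
      rw [key, h]
  rw [this]
  apply MeasurableSet.iInter
  intro a
  exact measurableSet_setOf.2
    ((measurableSet_setOf.1 (measurable_mem_sub _)).iff (measurableSet_setOf.1 (measurable_mem_sub _)))

namespace BratteliDiagram

variable {B : BratteliDiagram}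

theorem measurable_fix (g : ↥B.fullGroup) : MeasurableSet {x : B.Path | g • x = x} := by
  obtain ⟨m, hm⟩ := exists_lev g
  apply IsOpen.measurableSet
  apply IsClopen.isOpen
  apply Sat.isClopen (m := m)
  intro x y hxy hx
  apply eq_of_ag_of_tail (m := m)
  · have h1 := lev_ag hm hxy
    rw [show g • x = x from hx] at h1
    exact ag_trans (ag_symm h1) hxy
  · intro i hi
    exact lev_tail hm y i hi

theorem measurable_fix_pi {ι : Type*} [Countable ι] (g : ↥B.fullGroup) :
    MeasurableSet {y : ι → B.Path | g • y = y} := by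
  have : {y : ι → B.Path | g • y = y} = ⋂ q, (fun y : ι → B.Path => y q) ⁻¹' {x | g • x = x} := by
    ext y
    simp [funext_iff]
  rw [this]
  exact MeasurableSet.iInter fun q => measurable_pi_apply q (measurable_fix g)

theorem measure_FF (hsimple : B.IsSimple) (heven : B.IsEven)
    (k : ℕ) (μ : Fin k → Measure B.Path)
    (hprob : ∀ i, IsProbabilityMeasure (μ i))
    (φ : Measure (Subgroup ↥B.fullGroup)) (hφ : IsProbabilityMeasure φ)
    (c : (Fin k → ℕ) → ℝ≥0∞) (cinf : ℝ≥0∞)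
    (hsum : cinf + ∑' α : Fin k → ℕ, c α = 1)
    (hchar : ∀ g : ↥B.fullGroup,
      φ {H : Subgroup ↥B.fullGroup | conjSub g H = H}
        = ({1} : Set ↥B.fullGroup).indicator (fun _ => cinf) g
          + ∑' α : Fin k → ℕ,
              c α * B.prodMeasure μ α {y : (Σ i : Fin k, Fin (α i)) → B.Path | g • y = y})
    (A : Set B.Path) (hA : IsClopen A) (hne : A ≠ Set.univ) :
    φ (B.FF A) = ∑' α : Fin k → ℕ, c α * B.prodMeasure μ α
      {y : (Σ i : Fin k, Fin (α i)) → B.Path | ∀ q, y q ∈ A} := by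
  have hLK : ∀ n, B.GcircN n A ≤ B.Gcirc A := fun n => inf_le_right
  have hL := GcircN_mono A
  have hex : ∀ g ∈ B.Gcirc A, ∃ n, g ∈ B.GcircN n A := fun g hg => exists_GcircN hg
  have hcinf : cinf ≠ ⊤ := by
    intro h
    rw [h] at hsum
    simp at hsum
  have hcsum : ∑' α : Fin k → ℕ, c α ≠ ⊤ := by
    intro h
    rw [h] at hsum
    simp at hsum
  have hprodprob : ∀ α, IsProbabilityMeasure (B.prodMeasure μ α) := by
    intro α
    unfold prodMeasure
    infer_instance
  -- the three limits
  have lim1 := avg_tendsto hLK hL hex φ nrm (fun g => measurable_nrm g) (fun H => by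
    by_cases h : (nrm H).relIndex (B.Gcirc A) = 0
    · exact Or.inr h
    · exact Or.inl (le_of_relIndex hsimple heven hA hne _ h))
  obtain ⟨x0, hx0⟩ := (Set.ne_univ_iff_exists_notMem A).1 hne
  have hbot : (⊥ : Subgroup ↥B.fullGroup).relIndex (B.Gcirc A) = 0 :=
    orbit_infinite hsimple heven hA hne hx0 _ bot_le
  have lim2 : Tendsto (fun n => (∑ᶠ g : ↥(B.GcircN n A),
      ({1} : Set ↥B.fullGroup).indicator (fun _ => cinf) (g : ↥B.fullGroup))
        / (Nat.card ↥(B.GcircN n A) : ℝ≥0∞)) atTop (nhds 0) := by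
    have : IsFiniteMeasure (cinf • Measure.dirac ()) := ⟨by
      simpa using hcinf.lt_top⟩
    have h := avg_tendsto hLK hL hex (cinf • Measure.dirac ()) (fun _ => ⊥)
      (fun g => MeasurableSet.of_discrete) (fun _ => Or.inr hbot)
    have hz : ¬ B.Gcirc A ≤ ⊥ := by
      intro h
      rw [← Subgroup.relIndex_eq_one] at h
      omega
    have e0 : (cinf • Measure.dirac ()) {y : Unit | B.Gcirc A ≤ ⊥} = 0 := by
      simp [hz]
    have e1 : ∀ g : ↥B.fullGroup, (cinf • Measure.dirac ()) {y : Unit | g ∈ (⊥ : Subgroup ↥B.fullGroup)}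
        = ({1} : Set ↥B.fullGroup).indicator (fun _ => cinf) g := by
      intro g
      by_cases hg : g = 1 <;> simp [hg]
    rw [e0] at h
    simpa only [e1] using h
  have lim3 : ∀ α : Fin k → ℕ, Tendsto (fun n => (∑ᶠ g : ↥(B.GcircN n A), B.prodMeasure μ α
      {y : (Σ i : Fin k, Fin (α i)) → B.Path | (g : ↥B.fullGroup) • y = y})
        / (Nat.card ↥(B.GcircN n A) : ℝ≥0∞)) atTop
      (nhds (B.prodMeasure μ α {y : (Σ i : Fin k, Fin (α i)) → B.Path | ∀ q, y q ∈ A})) := by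
    intro α
    have hmemst : ∀ y : (Σ i : Fin k, Fin (α i)) → B.Path, (∀ q, y q ∈ A) →
        B.Gcirc A ≤ MulAction.stabilizer ↥B.fullGroup y := by
      intro y hy g hg
      rw [MulAction.mem_stabilizer_iff]
      funext q
      exact mem_Gcirc.1 hg _ (hy q)
    have hnst : ∀ y : (Σ i : Fin k, Fin (α i)) → B.Path, ¬ (∀ q, y q ∈ A) →
        (MulAction.stabilizer ↥B.fullGroup y).relIndex (B.Gcirc A) = 0 := by
      intro y hy
      push Not at hy
      obtain ⟨q, hq⟩ := hy
      apply orbit_infinite hsimple heven hA hne hq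
      intro g hg
      rw [MulAction.mem_stabilizer_iff] at hg ⊢
      exact congrFun hg q
    have h := avg_tendsto hLK hL hex (B.prodMeasure μ α)
      (fun y => MulAction.stabilizer ↥B.fullGroup y)
      (fun g => measurable_fix_pi g) (fun y => by
        by_cases hy : ∀ q, y q ∈ A
        · exact Or.inl (hmemst y hy)
        · exact Or.inr (hnst y hy))
    have hset : {y : (Σ i : Fin k, Fin (α i)) → B.Path |
        B.Gcirc A ≤ MulAction.stabilizer ↥B.fullGroup y} = {y | ∀ q, y q ∈ A} := by
      ext y
      constructor
      · intro hy
        by_contra hcon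
        have := hnst y hcon
        rw [Subgroup.relIndex_eq_one.2 hy] at this
        omega
      · exact hmemst y
    rw [hset] at h
    exact h
  have lim4 := tsum_tendsto (b := c) (f := fun n α => c α * ((∑ᶠ g : ↥(B.GcircN n A),
      B.prodMeasure μ α
      {y : (Σ i : Fin k, Fin (α i)) → B.Path | (g : ↥B.fullGroup) • y = y})
        / (Nat.card ↥(B.GcircN n A) : ℝ≥0∞))) hcsum (by
      intro n α
      have := Fintype.ofFinite ↥(B.GcircN n A)
      refine mul_le_of_le_one_right' ?_
      rw [finsum_eq_sum_of_fintype]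
      apply ENNReal.div_le_of_le_mul
      rw [one_mul, Nat.card_eq_fintype_card]
      refine (Finset.sum_le_card_nsmul _ _ 1 fun g _ => prob_le_one).trans ?_
      simp) (fun α => ENNReal.Tendsto.const_mul (lim3 α)
        (Or.inr (ne_top_of_le_ne_top hcsum (ENNReal.le_tsum α))))
  have lim5 := lim2.add lim4
  rw [zero_add] at lim5
  refine tendsto_nhds_unique lim1 (lim5.congr fun n => ?_)
  have := Fintype.ofFinite ↥(B.GcircN n A)
  simp only [finsum_eq_sum_of_fintype, div_eq_mul_inv]
  have e : ∀ g : ↥(B.GcircN n A), φ {H | (g : ↥B.fullGroup) ∈ nrm H}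
      = _ := fun g => hchar g
  simp only [e]
  rw [Finset.sum_add_distrib, add_mul]
  congr 1
  rw [← Summable.tsum_finsetSum (fun _ _ => ENNReal.summable), ← ENNReal.tsum_mul_right]
  apply tsum_congr
  intro α
  rw [← mul_assoc, Finset.mul_sum]

theorem measurable_FF (A : Set B.Path) : MeasurableSet (B.FF A) := by
  have : B.FF A = ⋂ g ∈ (B.Gcirc A : Set ↥B.fullGroup), {H | conjSub g H = H} := by
    ext H
    simp [FF]
  rw [this]
  exact MeasurableSet.biInter (Set.to_countable _) fun g _ => measurable_nrm g

theorem measurable_box {ι : Type*} [Countable ι] {A : Set B.Path} (hA : IsClopen A) :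
    MeasurableSet {y : ι → B.Path | ∀ q, y q ∈ A} := by
  rw [Set.ofPred_forall]
  exact MeasurableSet.iInter fun q => measurable_pi_apply q hA.isOpen.measurableSet

theorem union_aux (hsimple : B.IsSimple) {J : Type*}
    (φ : Measure (Subgroup ↥B.fullGroup)) [IsFiniteMeasure φ]
    {I : Type*} (T : I → Type) [∀ i, Countable (T i)] (ν : ∀ i, Measure (T i → B.Path))
    (c : I → ℝ≥0∞)
    (hbase : ∀ A : Set B.Path, IsClopen A → A ≠ Set.univ →
      φ (B.FF A) = ∑' i, c i * ν i {y | ∀ q, y q ∈ A})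
    (s : Finset J) : ∀ (A : J → Set B.Path), (∀ j ∈ s, IsClopen (A j)) →
      (∀ j ∈ s, ∀ l ∈ s, A j ∪ A l ≠ Set.univ) →
      φ (⋃ j ∈ s, B.FF (A j)) = ∑' i, c i * ν i (⋃ j ∈ s, {y | ∀ q, y q ∈ A j}) := by
  classical
  induction s using Finset.induction_on with
  | empty =>
    intro A _ _
    simp
  | insert j s hj ih =>
    intro A hcl hne
    have hcl' : ∀ l ∈ s, IsClopen (A l) := fun l hl => hcl l (Finset.mem_insert_of_mem hl)
    have hclj : IsClopen (A j) := hcl j (Finset.mem_insert_self _ _)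
    have hnej : A j ≠ Set.univ := by
      have := hne j (Finset.mem_insert_self _ _) j (Finset.mem_insert_self _ _)
      rwa [Set.union_self] at this
    have ih1 := ih A hcl' fun l hl l' hl' =>
      hne l (Finset.mem_insert_of_mem hl) l' (Finset.mem_insert_of_mem hl')
    have ih2 := ih (fun l => A j ∩ A l) (fun l hl => hclj.inter (hcl' l hl)) (by
      intro l hl l' hl' hcon
      apply hnej
      rw [Set.eq_univ_iff_forall] at hcon ⊢
      intro x
      rcases hcon x with h | h
      · exact h.1
      · exact h.1)
    have hb := hbase (A j) hclj hnej
    have hintg : B.FF (A j) ∩ ⋃ l ∈ s, B.FF (A l) = ⋃ l ∈ s, B.FF (A j ∩ A l) := by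
      rw [Set.inter_iUnion₂]
      apply Set.iUnion₂_congr
      intro l hl
      exact FF_inter hsimple hclj (hcl' l hl)
        (hne j (Finset.mem_insert_self _ _) l (Finset.mem_insert_of_mem hl))
    have hφ := measure_union_add_inter (μ := φ) (B.FF (A j)) (t := ⋃ l ∈ s, B.FF (A l))
      (Finset.measurableSet_biUnion _ fun l _ => measurable_FF (A l))
    rw [hintg, ih1, ih2, hb, ← ENNReal.tsum_add] at hφ
    have hν : ∀ i, c i * ν i {y | ∀ q, y q ∈ A j}
        + c i * ν i (⋃ l ∈ s, {y | ∀ q, y q ∈ A l})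
        = c i * ν i (⋃ l ∈ insert j s, {y | ∀ q, y q ∈ A l})
        + c i * ν i (⋃ l ∈ s, {y | ∀ q, y q ∈ A j ∩ A l}) := by
      intro i
      rw [← mul_add, ← mul_add, Finset.set_biUnion_insert]
      congr 1
      rw [← measure_union_add_inter (μ := ν i) {y | ∀ q, y q ∈ A j}
        (t := ⋃ l ∈ s, {y | ∀ q, y q ∈ A l})
        (Finset.measurableSet_biUnion _ fun l hl => measurable_box (hcl' l hl))]
      congr 2
      rw [Set.inter_iUnion₂]
      apply Set.iUnion₂_congr
      intro l hl
      ext y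
      simp [forall_and]
    simp only [hν] at hφ
    rw [ENNReal.tsum_add] at hφ
    rw [Finset.set_biUnion_insert]
    refine (ENNReal.add_left_inj ?_).1 hφ
    rw [← ih2]
    exact measure_ne_top _ _

end BratteliDiagram

/-- with `φ` and the decomposition as in Lemma `phi_FF_eq_sum`, and with a nested
sequence of finite clopen partitions of mesh tending to `0`, for any `n ≥ N` and `p ≤ r`,
`φ(⋃_{C̄∈Ξ_{p,n}} F(∪C̄)) = Σ_α c_α·μ_α(⋃_{C̄∈Ξ_{p,n}} (∪C̄)^{|α|})`. -/
theorem phi_union_FF_eq_sum (B : BratteliDiagram)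
    (hsimple : B.IsSimple) (heven : B.IsEven)
    (k : ℕ) (hk : 1 ≤ k) (μ : Fin k → Measure B.Path)
    (hprob : ∀ i, IsProbabilityMeasure (μ i))
    (hinv : ∀ i, MeasInv ↥B.fullGroup (μ i))
    (herg : ∀ i, MeasErg ↥B.fullGroup (μ i))
    (hdistinct : Function.Injective μ)
    (hcomplete : ∀ ν : Measure B.Path, IsProbabilityMeasure ν →
      MeasInv ↥B.fullGroup ν → MeasErg ↥B.fullGroup ν → ∃ i, ν = μ i)
    (φ : Measure (Subgroup ↥B.fullGroup)) (hφ : IsErgodicIRS ↥B.fullGroup φ)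
    (hatomless : ∀ H : Subgroup ↥B.fullGroup, φ {H} = 0)
    (c : (Fin k → ℕ) → ℝ≥0∞) (cinf : ℝ≥0∞)
    (hsum : cinf + ∑' α : Fin k → ℕ, c α = 1)
    (hchar : ∀ g : ↥B.fullGroup,
      φ {H : Subgroup ↥B.fullGroup | conjSub g H = H}
        = ({1} : Set ↥B.fullGroup).indicator (fun _ => cinf) g
          + ∑' α : Fin k → ℕ,
              c α * B.prodMeasure μ α {y : (Σ i : Fin k, Fin (α i)) → B.Path | g • y = y})
    (Ξ : ℕ → Finset (Set B.Path))
    (hclopen : ∀ n, ∀ C ∈ Ξ n, IsClopen C)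
    (hnonempty : ∀ n, ∀ C ∈ Ξ n, C.Nonempty)
    (hdisj : ∀ n, ∀ C ∈ Ξ n, ∀ D ∈ Ξ n, C ≠ D → Disjoint C D)
    (hcover : ∀ n, ⋃₀ (↑(Ξ n) : Set (Set B.Path)) = Set.univ)
    (hnested : ∀ n, ∀ C ∈ Ξ (n + 1), ∃ D ∈ Ξ n, C ⊆ D)
    (hmesh : ∀ U ∈ uniformity B.Path, ∀ᶠ n in Filter.atTop, ∀ C ∈ Ξ n, C ×ˢ C ⊆ U)
    (r : ℕ) (hr : 1 ≤ r) (N : ℕ)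
    (hN : ∀ p ≤ r, ∀ n, N ≤ n →
      ∀ S ∈ Finset.powersetCard p (Ξ n), ∀ T ∈ Finset.powersetCard p (Ξ n),
        ⋃₀ (↑S : Set (Set B.Path)) ∪ ⋃₀ (↑T : Set (Set B.Path)) ≠ Set.univ)
    (n : ℕ) (hn : N ≤ n) (p : ℕ) (hp : p ≤ r) :
    φ (⋃ S ∈ Finset.powersetCard p (Ξ n), B.FF (⋃₀ (↑S : Set (Set B.Path))))
      = ∑' α : Fin k → ℕ,
          c α * B.prodMeasure μ α
            (⋃ S ∈ Finset.powersetCard p (Ξ n),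
              {y : (Σ i : Fin k, Fin (α i)) → B.Path |
                ∀ q, y q ∈ ⋃₀ (↑S : Set (Set B.Path))}) := by
  have hp1 : IsProbabilityMeasure φ := hφ.1.1
  have hcl : ∀ S ∈ Finset.powersetCard p (Ξ n), IsClopen (⋃₀ (↑S : Set (Set B.Path))) := by
    intro S hS
    rw [Set.sUnion_eq_biUnion]
    exact Set.Finite.isClopen_biUnion S.finite_toSet
      fun C hC => hclopen n C ((Finset.mem_powersetCard.1 hS).1 hC)
  exact BratteliDiagram.union_aux hsimple φ (fun α : Fin k → ℕ => Σ i : Fin k, Fin (α i))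
    (fun α => B.prodMeasure μ α) c
    (BratteliDiagram.measure_FF hsimple heven k μ hprob φ hp1 c cinf hsum hchar)
    (Finset.powersetCard p (Ξ n)) (fun S => ⋃₀ (↑S : Set (Set B.Path))) hcl (hN p hp n hn)
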